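/- For every β ≥ 0: Z^NE_{β,L} ≤ Z_{β,L} for every L ∈ ℕ, and there exists a function ε : ℕ → [0,∞) (depending on β) with ε(L)/L → 0 as L → ∞ such that Z_{β,L} ≤ e^{ε(L)} · Z^NE_{β,L} for every L ∈ ℕ. -/

import Mathlib

open Filter

/-! ## Paths on `ℤ²` encoded by direction sequences -/

/-- The four unit steps of `ℤ²`: right, left, up, down. -/
def dirs : Fin 4 → ℤ × ℤ := ![(1, 0), (-1, 0), (0, 1), (0, -1)]

/-- The list of steps (increments) of an `L`-step path encoded by a direction sequence. -/
def stepsOf {L : ℕ} (s : Fin L → Fin 4) : List (ℤ × ℤ) := (List.ofFn s).map dirs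

/-- The position `w_i` of the path after `i` steps; `w_0 = (0,0)`. -/
def pt (steps : List (ℤ × ℤ)) (i : ℕ) : ℤ × ℤ := (steps.take i).sum

/-- Self-avoiding: the sites `w_0, …, w_L` are pairwise distinct. -/
def IsSA (steps : List (ℤ × ℤ)) : Prop :=
  ∀ i ≤ steps.length, ∀ j ≤ steps.length, pt steps i = pt steps j → i = j

/-- Prudent: no step points towards a previously visited site, i.e. for every
`i < L`, every `k ≥ 1` and every `j ≤ i`, `w_i + k (w_{i+1} - w_i) ≠ w_j`. -/
def IsPrudent (steps : List (ℤ × ℤ)) : Prop :=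
  ∀ i < steps.length, ∀ k : ℕ, 1 ≤ k → ∀ j ≤ i,
    pt steps i + (k : ℤ) • steps.getD i (0, 0) ≠ pt steps j

/-- Twice the midpoint `u_{i+1}` of step number `i` (0-indexed): `w_i + w_{i+1}`. -/
def dmid (steps : List (ℤ × ℤ)) (i : ℕ) : ℤ × ℤ := pt steps i + pt steps (i + 1)

/-- The Hamiltonian `H(w)`: the number of pairs `1 ≤ i < j ≤ L` with
`‖u_i - u_j‖ = 1`, i.e. whose doubled midpoints differ by a vector of squared
Euclidean norm `4`. -/
noncomputable def Ham (steps : List (ℤ × ℤ)) : ℕ :=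
  ((Finset.range steps.length ×ˢ Finset.range steps.length).filter fun p =>
      p.1 < p.2 ∧ (dmid steps p.1 - dmid steps p.2).1 ^ 2 +
        (dmid steps p.1 - dmid steps p.2).2 ^ 2 = 4).card

/-! ## IPSAW -/

open scoped Classical in
/-- `Ω_L^PSAW`: the set of `L`-step prudent paths. -/
noncomputable def psawFinset (L : ℕ) : Finset (Fin L → Fin 4) :=
  Finset.univ.filter fun s => IsPrudent (stepsOf s)

/-- `Z_{β,L}`: the partition function of IPSAW. -/
noncomputable def Zpsaw (β : ℝ) (L : ℕ) : ℝ :=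
  ∑ s ∈ psawFinset L, Real.exp (β * (Ham (stepsOf s) : ℝ))

/-! ## Partially directed paths, oriented blocks and NE-prudent paths -/

/-- The vertical run of steps corresponding to a (signed) stretch `ℓ`. -/
def vrun (ℓ : ℤ) : List (ℤ × ℤ) := List.replicate ℓ.natAbs (if 0 ≤ ℓ then (0, 1) else (0, -1))

/-- The horizontal run of steps corresponding to a (signed) stretch `ℓ`. -/
def hrun (ℓ : ℤ) : List (ℤ × ℤ) := List.replicate ℓ.natAbs (if 0 ≤ ℓ then (1, 0) else (-1, 0))

/-- The west-east partially directed path with stretch sequence `ℓs`: vertical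
runs separated by single horizontal inter-stretch steps. -/
def weSteps (ℓs : List ℤ) : List (ℤ × ℤ) := List.intercalate [(1, 0)] (ℓs.map vrun)

/-- The south-north partially directed path with stretch sequence `ℓs`: horizontal
runs separated by single vertical inter-stretch steps. -/
def snSteps (ℓs : List ℤ) : List (ℤ × ℤ) := List.intercalate [(0, 1)] (ℓs.map hrun)

/-- The upper exit condition: `ℓ_1 + ⋯ + ℓ_N > max_{0 ≤ i < N} (ℓ_1 + ⋯ + ℓ_i)`. -/
def upperExit (ℓs : List ℤ) : Prop := ∀ i < ℓs.length, (ℓs.take i).sum < ℓs.sum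

/-- A block of given type: `true` = west-east, `false` = south-north. -/
def blockSteps : Bool → List ℤ → List (ℤ × ℤ)
  | true, ℓs => weSteps ℓs
  | false, ℓs => snSteps ℓs

/-- The concatenation of a sequence of blocks of alternating type, starting with
type `b`. -/
def neSteps : Bool → List (List ℤ) → List (ℤ × ℤ)
  | _, [] => []
  | b, ℓs :: rest => blockSteps b ℓs ++ neSteps (!b) rest

/-- Block data of an NE-prudent path: a nonempty sequence of nonempty stretch
sequences, all blocks but the last satisfying the upper exit condition, and all
blocks but the first having a negative first stretch. -/
def IsNEData (bs : List (List ℤ)) : Prop :=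
  bs ≠ [] ∧ (∀ ℓs ∈ bs, ℓs ≠ []) ∧
  (∀ i : ℕ, i + 1 < bs.length → upperExit (bs.getD i [])) ∧
  (∀ i : ℕ, 0 < i → i < bs.length → (bs.getD i []).headI < 0)

/-- An NE-prudent path: a prudent path obtained as the concatenation of oriented
blocks of alternating type as prescribed by `IsNEData`. -/
def IsNEPath (steps : List (ℤ × ℤ)) : Prop :=
  IsPrudent steps ∧ ∃ (b : Bool) (bs : List (List ℤ)), IsNEData bs ∧ neSteps b bs = steps

open scoped Classical in
/-- `Ω_L^NE`: the set of `L`-step NE-prudent paths. -/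
noncomputable def neFinset (L : ℕ) : Finset (Fin L → Fin 4) :=
  Finset.univ.filter fun s => IsNEPath (stepsOf s)

/-- `Z^NE_{β,L}`: the partition function of NE-IPSAW. -/
noncomputable def Zne (β : ℝ) (L : ℕ) : ℝ :=
  ∑ s ∈ neFinset L, Real.exp (β * (Ham (stepsOf s) : ℝ))

/-! ## Starred and tilde NE sets -/

/-- Block data where all blocks, including the last one, satisfy the upper exit
condition. -/
def IsNEStarData (bs : List (List ℤ)) : Prop :=
  bs ≠ [] ∧ (∀ ℓs ∈ bs, ℓs ≠ []) ∧
  (∀ i : ℕ, i < bs.length → upperExit (bs.getD i [])) ∧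
  (∀ i : ℕ, 0 < i → i < bs.length → (bs.getD i []).headI < 0)

/-- Membership in `Ω_L^{NE,*}`. -/
def IsNEStar (steps : List (ℤ × ℤ)) : Prop :=
  IsPrudent steps ∧ ∃ (b : Bool) (bs : List (List ℤ)), IsNEStarData bs ∧ neSteps b bs = steps

/-- Membership in `Ω̃_L^{NE,*}`: moreover the first stretch of the path has length `0`. -/
def IsNETilde (steps : List (ℤ × ℤ)) : Prop :=
  IsPrudent steps ∧ ∃ (b : Bool) (bs : List (List ℤ)), IsNEStarData bs ∧
    bs.headI.headI = 0 ∧ neSteps b bs = steps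

open scoped Classical in
noncomputable def neStarFinset (L : ℕ) : Finset (Fin L → Fin 4) :=
  Finset.univ.filter fun s => IsNEStar (stepsOf s)

open scoped Classical in
noncomputable def neTildeFinset (L : ℕ) : Finset (Fin L → Fin 4) :=
  Finset.univ.filter fun s => IsNETilde (stepsOf s)

/-- `Z^{NE,*}_{β,L}`. -/
noncomputable def Zstar (β : ℝ) (L : ℕ) : ℝ :=
  ∑ s ∈ neStarFinset L, Real.exp (β * (Ham (stepsOf s) : ℝ))

/-- `Z̃^{NE,*}_{β,L}`. -/
noncomputable def Ztilde (β : ℝ) (L : ℕ) : ℝ :=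
  ∑ s ∈ neTildeFinset L, Real.exp (β * (Ham (stepsOf s) : ℝ))

/-! ## IPDSAW and ISAW -/

/-- A west-east partially directed self-avoiding path: increments in
`{(1,0),(0,1),(0,-1)}` and self-avoiding. -/
def IsPD (steps : List (ℤ × ℤ)) : Prop :=
  (∀ d ∈ steps, d = (1, 0) ∨ d = (0, 1) ∨ d = (0, -1)) ∧ IsSA steps

open scoped Classical in
/-- `Ω_L^PDSAW`. -/
noncomputable def pdFinset (L : ℕ) : Finset (Fin L → Fin 4) :=
  Finset.univ.filter fun s => IsPD (stepsOf s)

/-- `Z^IPDSAW_{β,L}`. -/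
noncomputable def Zipd (β : ℝ) (L : ℕ) : ℝ :=
  ∑ s ∈ pdFinset L, Real.exp (β * (Ham (stepsOf s) : ℝ))

open scoped Classical in
/-- `Ω_L^SAW`. -/
noncomputable def sawFinset (L : ℕ) : Finset (Fin L → Fin 4) :=
  Finset.univ.filter fun s => IsSA (stepsOf s)

/-- `Z^ISAW_{β,L}`. -/
noncomputable def Zisaw (β : ℝ) (L : ℕ) : ℝ :=
  ∑ s ∈ sawFinset L, Real.exp (β * (Ham (stepsOf s) : ℝ))

/-! ## Orientations of two-sided paths -/

/-- The four possible general orientations of a two-sided prudent path. -/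
inductive Orient | NE | NW | SE | SW
deriving DecidableEq

/-- The axial symmetry of `ℤ²` turning an NE-oriented object into an
`x`-oriented one, acting on steps. -/
def osym : Orient → ℤ × ℤ → ℤ × ℤ
  | Orient.NE, d => d
  | Orient.NW, d => (-d.1, d.2)
  | Orient.SE, d => (d.1, -d.2)
  | Orient.SW, d => (-d.1, -d.2)

/-! ## Prudent coordinate sequences -/

/-- Coordinates of an `N`-step nearest-neighbour path no step of which points towards a
previously visited site. -/
structure PrudFn (N : ℕ) (x y : ℕ → ℤ) : Prop where
  step : ∀ i < N, (x (i + 1) = x i + 1 ∧ y (i + 1) = y i) ∨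
    (x (i + 1) = x i - 1 ∧ y (i + 1) = y i) ∨
    (x (i + 1) = x i ∧ y (i + 1) = y i + 1) ∨ (x (i + 1) = x i ∧ y (i + 1) = y i - 1)
  right : ∀ i < N, x (i + 1) = x i + 1 → ∀ j ≤ i, y j = y i → x j ≤ x i
  left : ∀ i < N, x (i + 1) = x i - 1 → ∀ j ≤ i, y j = y i → x i ≤ x j
  up : ∀ i < N, y (i + 1) = y i + 1 → ∀ j ≤ i, x j = x i → y j ≤ y i
  down : ∀ i < N, y (i + 1) = y i - 1 → ∀ j ≤ i, x j = x i → y i ≤ y j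

/-- The value at time `i` is a weak record. -/
def IsRec (x : ℕ → ℤ) (i : ℕ) : Prop := ∀ j ≤ i, x j ≤ x i

/-- Step `i` reaches a strict record. -/
def Rise (x : ℕ → ℤ) (i : ℕ) : Prop := ∀ j ≤ i, x j < x (i + 1)

/-- Step `i` leaves the bounding box of the path up to time `i`. -/
def LeavesBox (x y : ℕ → ℤ) (i : ℕ) : Prop := Rise x i ∨ Rise (-x) i ∨ Rise y i ∨ Rise (-y) i

theorem leavesBox_swap {x y : ℕ → ℤ} {i : ℕ} : LeavesBox y x i ↔ LeavesBox x y i := by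
  unfold LeavesBox; tauto

theorem leavesBox_negX {x y : ℕ → ℤ} {i : ℕ} : LeavesBox (-x) y i ↔ LeavesBox x y i := by
  unfold LeavesBox; rw [neg_neg]; tauto

theorem leavesBox_negY {x y : ℕ → ℤ} {i : ℕ} : LeavesBox x (-y) i ↔ LeavesBox x y i := by
  unfold LeavesBox; rw [neg_neg]; tauto

theorem exists_eq_of_unit_steps {f : ℕ → ℤ} {a : ℕ} {c : ℤ} (n : ℕ)
    (hf : ∀ i, a ≤ i → i < a + n → f (i + 1) ≤ f i + 1) (ha : f a ≤ c) (hb : c ≤ f (a + n)) :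
    ∃ k, a ≤ k ∧ k ≤ a + n ∧ f k = c := by
  induction n with
  | zero => exact ⟨a, le_rfl, by simp, by simpa using le_antisymm ha hb⟩
  | succ n ih =>
    by_cases h : c ≤ f (a + n)
    · obtain ⟨k, h1, h2, h3⟩ := ih (fun i h1 h2 => hf i h1 (by omega)) h
      exact ⟨k, h1, by omega, h3⟩
    · have := hf (a + n) (by omega) (by omega)
      refine ⟨a + n + 1, by omega, by omega, ?_⟩
      have hb' : c ≤ f (a + n + 1) := hb
      omega

namespace PrudFn

variable {N : ℕ} {x y : ℕ → ℤ}

theorem swap (h : PrudFn N x y) : PrudFn N y x where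
  step i hi := by rcases h.step i hi with h | h | h | h <;> omega
  right := h.up
  left := h.down
  up := h.right
  down := h.left

theorem negX (h : PrudFn N x y) : PrudFn N (-x) y where
  step i hi := by
    simp only [Pi.neg_apply]; rcases h.step i hi with h | h | h | h <;> omega
  right i hi e j hj q := by
    simp only [Pi.neg_apply] at *; have := h.left i hi (by omega) j hj q; omega
  left i hi e j hj q := by
    simp only [Pi.neg_apply] at *; have := h.right i hi (by omega) j hj q; omega
  up i hi e j hj q := h.up i hi e j hj (by simpa using q)
  down i hi e j hj q := h.down i hi e j hj (by simpa using q)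

theorem negY (h : PrudFn N x y) : PrudFn N x (-y) := h.swap.negX.swap

theorem mono (h : PrudFn N x y) {n : ℕ} (hn : n ≤ N) : PrudFn n x y where
  step i hi := h.step i (by omega)
  right i hi := h.right i (by omega)
  left i hi := h.left i (by omega)
  up i hi := h.up i (by omega)
  down i hi := h.down i (by omega)

theorem translate (h : PrudFn N x y) (a b : ℤ) :
    PrudFn N (fun i => x i + a) (fun i => y i + b) where
  step i hi := by
    have := h.step i hi; omega
  right i hi e j hj q := by
    have := h.right i hi (by omega) j hj (by omega); omega
  left i hi e j hj q := by
    have := h.left i hi (by omega) j hj (by omega); omega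
  up i hi e j hj q := by
    have := h.up i hi (by omega) j hj (by omega); omega
  down i hi e j hj q := by
    have := h.down i hi (by omega) j hj (by omega); omega

theorem shift (h : PrudFn N x y) {t m : ℕ} (hm : t + m ≤ N) :
    PrudFn m (fun i => x (t + i)) (fun i => y (t + i)) where
  step i hi := h.step (t + i) (by omega)
  right i hi e j hj := h.right (t + i) (by omega) e (t + j) (by omega)
  left i hi e j hj := h.left (t + i) (by omega) e (t + j) (by omega)
  up i hi e j hj := h.up (t + i) (by omega) e (t + j) (by omega)
  down i hi e j hj := h.down (t + i) (by omega) e (t + j) (by omega)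

theorem congr (h : PrudFn N x y) {x' y' : ℕ → ℤ} (hx : ∀ i ≤ N, x' i = x i)
    (hy : ∀ i ≤ N, y' i = y i) : PrudFn N x' y' where
  step i hi := by
    rw [hx i (by omega), hx (i + 1) (by omega), hy i (by omega), hy (i + 1) (by omega)]
    exact h.step i hi
  right i hi e j hj := by
    rw [hx i (by omega), hx (i + 1) (by omega)] at e
    rw [hx i (by omega), hx j (by omega), hy i (by omega), hy j (by omega)]
    exact h.right i hi e j hj
  left i hi e j hj := by
    rw [hx i (by omega), hx (i + 1) (by omega)] at e
    rw [hx i (by omega), hx j (by omega), hy i (by omega), hy j (by omega)]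
    exact h.left i hi e j hj
  up i hi e j hj := by
    rw [hy i (by omega), hy (i + 1) (by omega)] at e
    rw [hx i (by omega), hx j (by omega), hy i (by omega), hy j (by omega)]
    exact h.up i hi e j hj
  down i hi e j hj := by
    rw [hy i (by omega), hy (i + 1) (by omega)] at e
    rw [hx i (by omega), hx j (by omega), hy i (by omega), hy j (by omega)]
    exact h.down i hi e j hj

/-- Prudent paths are self-avoiding. -/
theorem ne_of_lt (h : PrudFn N x y) {i j : ℕ} (hij : i < j) (hj : j ≤ N) (hx : x i = x j) :
    y i ≠ y j := by
  intro hy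
  obtain ⟨k, rfl⟩ : ∃ k, j = k + 1 := ⟨j - 1, by omega⟩
  rcases h.step k (by omega) with ⟨a, b⟩ | ⟨a, b⟩ | ⟨a, b⟩ | ⟨a, b⟩
  · have := h.right k (by omega) a i (by omega) (by omega); omega
  · have := h.left k (by omega) a i (by omega) (by omega); omega
  · have := h.up k (by omega) b i (by omega) (by omega); omega
  · have := h.down k (by omega) b i (by omega) (by omega); omega

theorem eq_of_eq (h : PrudFn N x y) {i j : ℕ} (hi : i ≤ N) (hj : j ≤ N) (hx : x i = x j)
    (hy : y i = y j) : i = j := by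
  rcases lt_trichotomy i j with hlt | rfl | hlt
  · exact absurd hy (h.ne_of_lt hlt hj hx)
  · rfl
  · exact absurd hy.symm (h.ne_of_lt hlt hi hx.symm)

theorem right_step_of_boundary (h : PrudFn N x y) {i : ℕ} (hi : i < N)
    (e : x (i + 1) = x i + 1)
    (hb : IsRec x i ∨ IsRec (-x) i ∨ IsRec y i ∨ IsRec (-y) i) :
    Rise x i ∨ IsRec y i ∨ IsRec (-y) i := by
  rcases hb with hb | hb | hb | hb
  · left; intro j hj; have := hb j hj; omega
  · right
    by_contra hc
    simp only [IsRec, Pi.neg_apply] at hc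
    push Not at hc
    obtain ⟨⟨a, ha, ha'⟩, b, hb1, hb'⟩ := hc
    have key : ∃ k, k < i ∧ y k = y i := by
      rcases le_total a b with hab | hab
      · obtain ⟨k, h1, h2, h3⟩ := exists_eq_of_unit_steps (f := -y) (a := a) (c := -y i) (b - a)
          (fun j h1 h2 => by
            have := h.step j (by omega)
            simp only [Pi.neg_apply]; omega) (by simp only [Pi.neg_apply]; omega)
          (by rw [Nat.add_sub_cancel' hab]; simp only [Pi.neg_apply]; omega)
        simp only [Pi.neg_apply] at h3
        refine ⟨k, lt_of_le_of_ne (by omega) ?_, by omega⟩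
        rintro rfl
        have : k = b := by omega
        subst this; omega
      · obtain ⟨k, h1, h2, h3⟩ := exists_eq_of_unit_steps (f := y) (a := b) (c := y i) (a - b)
          (fun j h1 h2 => by
            have := h.step j (by omega)
            omega) (by omega)
          (by rw [Nat.add_sub_cancel' hab]; omega)
        refine ⟨k, lt_of_le_of_ne (by omega) ?_, by omega⟩
        rintro rfl
        have : k = a := by omega
        subst this; omega
    obtain ⟨k, hk, hky⟩ := key
    have h1 := h.right i hi e k hk.le hky
    have h2 := hb k hk.le
    simp only [Pi.neg_apply] at h2
    exact h.ne_of_lt hk hi.le (by omega) hky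
  · exact .inr (.inl hb)
  · exact .inr (.inr hb)

theorem horizontal_step_of_boundary (h : PrudFn N x y) {i : ℕ} (hi : i < N)
    (e : y (i + 1) = y i)
    (hb : IsRec x i ∨ IsRec (-x) i ∨ IsRec y i ∨ IsRec (-y) i) :
    Rise x i ∨ Rise (-x) i ∨ IsRec y i ∨ IsRec (-y) i := by
  rcases h.step i hi with ⟨a, b⟩ | ⟨a, b⟩ | ⟨a, b⟩ | ⟨a, b⟩
  · have := h.right_step_of_boundary hi a hb; tauto
  · have := h.negX.right_step_of_boundary hi (by simp only [Pi.neg_apply]; omega)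
      (by rw [neg_neg]; tauto)
    tauto
  · omega
  · omega

theorem boundary_succ_of_horizontal {i : ℕ} (e : y (i + 1) = y i)
    (h : Rise x i ∨ Rise (-x) i ∨ IsRec y i ∨ IsRec (-y) i) :
    IsRec x (i + 1) ∨ IsRec (-x) (i + 1) ∨ IsRec y (i + 1) ∨ IsRec (-y) (i + 1) := by
  have rise : ∀ z : ℕ → ℤ, Rise z i → IsRec z (i + 1) := fun z hz j hj => by
    rcases Nat.lt_or_ge i j with h | h
    · rw [show j = i + 1 by omega]
    · exact (hz j h).le
  have flat : ∀ z : ℕ → ℤ, z (i + 1) = z i → IsRec z i → IsRec z (i + 1) := fun z e hz j hj => by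
    rcases Nat.lt_or_ge i j with h | h
    · rw [show j = i + 1 by omega]
    · rw [e]; exact hz j h
  rcases h with h | h | h | h
  · exact .inl (rise _ h)
  · exact .inr (.inl (rise _ h))
  · exact .inr (.inr (.inl (flat _ e h)))
  · exact .inr (.inr (.inr (flat _ (by simp [e]) h)))

/-- The endpoint of a prudent path lies on the boundary of its bounding box. -/
theorem boundary (h : PrudFn N x y) {i : ℕ} (hi : i ≤ N) :
    IsRec x i ∨ IsRec (-x) i ∨ IsRec y i ∨ IsRec (-y) i := by
  induction i with
  | zero =>
    left
    intro j hj
    rw [Nat.le_zero.1 hj]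
  | succ i ih =>
    have hb := ih (by omega)
    by_cases e : y (i + 1) = y i
    · exact boundary_succ_of_horizontal e (h.horizontal_step_of_boundary (by omega) e hb)
    · have e' : x (i + 1) = x i := by have := h.step i (by omega); omega
      have := boundary_succ_of_horizontal e'
        (h.swap.horizontal_step_of_boundary (by omega) e' (by tauto))
      tauto

/-- A horizontal step leaves the bounding box or runs along its top or bottom side. -/
theorem horizontal_step (h : PrudFn N x y) {i : ℕ} (hi : i < N) (e : y (i + 1) = y i) :
    Rise x i ∨ Rise (-x) i ∨ IsRec y i ∨ IsRec (-y) i :=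
  h.horizontal_step_of_boundary hi e (h.boundary hi.le)

theorem vertical_step (h : PrudFn N x y) {i : ℕ} (hi : i < N) (e : x (i + 1) = x i) :
    Rise y i ∨ Rise (-y) i ∨ IsRec x i ∨ IsRec (-x) i :=
  h.swap.horizontal_step hi e

theorem leavesBox_of_right_turn (h : PrudFn N x y) {i : ℕ} (hi : i + 1 < N)
    (e : x (i + 1) = x i + 1) (ev : x (i + 2) = x (i + 1)) (hy : IsRec y i)
    (h0 : ¬ LeavesBox x y i) : LeavesBox x y (i + 1) := by
  by_contra h1
  have ey : y (i + 1) = y i := by have := h.step i (by omega); omega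
  have ev' : x (i + 1 + 1) = x (i + 1) := ev
  simp only [LeavesBox, not_or] at h0 h1
  have hx : IsRec x (i + 1) := by
    rcases h.vertical_step hi ev with a | a | a | a
    · exact absurd a h1.2.2.1
    · exact absurd a h1.2.2.2
    · exact a
    · have := a i (by omega)
      simp only [Pi.neg_apply] at this; omega
  obtain ⟨k, hk, hk'⟩ : ∃ k ≤ i, x (i + 1) ≤ x k := by
    have := h0.1
    unfold Rise at this
    push Not at this
    exact this
  have hxk := hx k (by omega)
  have hyk := hy k hk
  have hne : y k ≠ y i := fun q => by
    have := h.right i (by omega) e k hk q; omega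
  rcases h.step (i + 1) hi with ⟨a, b⟩ | ⟨a, b⟩ | ⟨a, b⟩ | ⟨a, b⟩
  · omega
  · omega
  · apply h1.2.2.1
    intro j hj
    have : y j ≤ y (i + 1) := by
      rcases Nat.lt_or_ge i j with h | h
      · rw [show j = i + 1 by omega]
      · rw [ey]; exact hy j h
    omega
  · have := h.down (i + 1) hi b k (by omega) (by omega)
    omega

theorem leavesBox_of_horizontal_turn (h : PrudFn N x y) {i : ℕ} (hi : i + 1 < N)
    (e : y (i + 1) = y i) (ev : x (i + 2) = x (i + 1))
    (h0 : ¬ LeavesBox x y i) : LeavesBox x y (i + 1) := by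
  have aux : ∀ x y : ℕ → ℤ, PrudFn N x y → x (i + 2) = x (i + 1) → x (i + 1) = x i + 1 →
      y (i + 1) = y i → ¬ LeavesBox x y i → LeavesBox x y (i + 1) := by
    intro x y h ev ex e h0
    have h0' := h0
    simp only [LeavesBox, not_or] at h0'
    rcases h.horizontal_step (by omega) e with a | a | a | a
    · exact absurd a h0'.1
    · exact absurd a h0'.2.1
    · exact h.leavesBox_of_right_turn hi ex ev a h0
    · exact leavesBox_negY.1 (h.negY.leavesBox_of_right_turn hi ex ev a (by rwa [leavesBox_negY]))
  rcases h.step i (by omega) with ⟨a, b⟩ | ⟨a, b⟩ | ⟨a, b⟩ | ⟨a, b⟩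
  · exact aux x y h ev a e h0
  · exact leavesBox_negX.1 (aux (-x) y h.negX (by simp [ev]) (by simp [a]; omega) e
      (by rwa [leavesBox_negX]))
  · omega
  · omega

/-- Two consecutive steps staying in the bounding box have the same direction. -/
theorem straight_of_not_leavesBox (h : PrudFn N x y) {i : ℕ} (hi : i + 1 < N)
    (h0 : ¬ LeavesBox x y i) (h1 : ¬ LeavesBox x y (i + 1)) :
    x (i + 2) - x (i + 1) = x (i + 1) - x i ∧ y (i + 2) - y (i + 1) = y (i + 1) - y i := by
  by_cases e : y (i + 1) = y i
  · by_cases ev : x (i + 2) = x (i + 1)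
    · exact absurd (h.leavesBox_of_horizontal_turn hi e ev h0) h1
    · rcases h.step i (by omega) with ⟨a, b⟩ | ⟨a, b⟩ | ⟨a, b⟩ | ⟨a, b⟩ <;>
      rcases h.step (i + 1) (by omega) with ⟨c, d⟩ | ⟨c, d⟩ | ⟨c, d⟩ | ⟨c, d⟩ <;>
      have c' : x (i + 2) = _ := c <;> have d' : y (i + 2) = _ := d <;> try omega
      · have := h.left (i + 1) hi c i (by omega) (by omega); omega
      · have := h.right (i + 1) hi c i (by omega) (by omega); omega
  · by_cases ev : y (i + 2) = y (i + 1)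
    · have e' : x (i + 1) = x i := by have := h.step i (by omega); omega
      have := h.swap.leavesBox_of_horizontal_turn hi e' ev (by rwa [leavesBox_swap])
      exact absurd (leavesBox_swap.1 this) h1
    · rcases h.step i (by omega) with ⟨a, b⟩ | ⟨a, b⟩ | ⟨a, b⟩ | ⟨a, b⟩ <;>
      rcases h.step (i + 1) (by omega) with ⟨c, d⟩ | ⟨c, d⟩ | ⟨c, d⟩ | ⟨c, d⟩ <;>
      have c' : x (i + 2) = _ := c <;> have d' : y (i + 2) = _ := d <;> try omega
      · have := h.down (i + 1) hi d i (by omega) (by omega); omega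
      · have := h.up (i + 1) hi d i (by omega) (by omega); omega

end PrudFn

/-! ## Runs along the sides of the bounding box, and self-touchings -/

open scoped Classical in
/-- The number of steps since the path last left its bounding box. -/
noncomputable def runPos (x y : ℕ → ℤ) : ℕ → ℕ
  | 0 => 0
  | n + 1 => if LeavesBox x y (n + 1) then 0 else runPos x y n + 1

theorem runPos_le (x y : ℕ → ℤ) (n : ℕ) : runPos x y n ≤ n := by
  induction n with
  | zero => simp [runPos]
  | succ n ih => rw [runPos]; split_ifs <;> omega

theorem not_leavesBox_of_lt_runPos {x y : ℕ → ℤ} {n k : ℕ} (hk : k < runPos x y n) :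
    ¬ LeavesBox x y (n - k) := by
  induction n generalizing k with
  | zero => simp [runPos] at hk
  | succ n ih =>
    rw [runPos] at hk
    split_ifs at hk with hl
    · omega
    · rcases k with _ | k
      · simpa using hl
      · have := ih (k := k) (by omega)
        rwa [show n + 1 - (k + 1) = n - k by omega]

theorem runPos_succ_le (x y : ℕ → ℤ) (n : ℕ) : runPos x y (n + 1) ≤ runPos x y n + 1 := by
  rw [runPos]; split_ifs <;> omega

/-- The midpoints of steps `i` and `j` are at distance one. -/
def Touch (x y : ℕ → ℤ) (i j : ℕ) : Prop :=
  (x i + x (i + 1) - (x j + x (j + 1))) ^ 2 + (y i + y (i + 1) - (y j + y (j + 1))) ^ 2 = 4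

instance (x y : ℕ → ℤ) (i j : ℕ) : Decidable (Touch x y i j) := by
  unfold Touch; infer_instance

theorem touch_swap {x y : ℕ → ℤ} {i j : ℕ} : Touch y x i j ↔ Touch x y i j := by
  unfold Touch; rw [add_comm]

theorem touch_negX {x y : ℕ → ℤ} {i j : ℕ} : Touch (-x) y i j ↔ Touch x y i j := by
  unfold Touch
  simp only [Pi.neg_apply]
  rw [show -x i + -x (i + 1) - (-x j + -x (j + 1)) = -(x i + x (i + 1) - (x j + x (j + 1))) by ring,
    neg_sq]

theorem touch_negY {x y : ℕ → ℤ} {i j : ℕ} : Touch x (-y) i j ↔ Touch x y i j := by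
  rw [← touch_swap, touch_negX, touch_swap]

theorem sq_add_sq_eq_four {a b : ℤ} (h : a ^ 2 + b ^ 2 = 4) :
    (a = 2 ∨ a = -2) ∧ b = 0 ∨ a = 0 ∧ (b = 2 ∨ b = -2) := by
  have ha : a ≤ 2 := by nlinarith [sq_nonneg b]
  have ha' : -2 ≤ a := by nlinarith [sq_nonneg b]
  have hb : b ≤ 2 := by nlinarith [sq_nonneg a]
  have hb' : -2 ≤ b := by nlinarith [sq_nonneg a]
  interval_cases a <;> interval_cases b <;> omega

/-- The number of steps in `[s, j)` touched by step `j`. -/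
def touchCount (x y : ℕ → ℤ) (s j : ℕ) : ℕ :=
  ((Finset.Ico s j).filter fun i => Touch x y i j).card

/-- The coordinate-function form of the Hamiltonian. -/
def hamFn (x y : ℕ → ℤ) (n : ℕ) : ℕ := ∑ j ∈ Finset.range n, touchCount x y 0 j

theorem Ham_eq_hamFn (s : List (ℤ × ℤ)) :
    Ham s = hamFn (fun i => (pt s i).1) (fun i => (pt s i).2) s.length := by
  unfold Ham hamFn touchCount
  rw [Finset.card_filter, Finset.sum_product_right]
  refine Finset.sum_congr rfl fun j hj => ?_
  rw [← Finset.card_filter]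
  congr 1
  ext i
  simp only [Finset.mem_filter, Finset.mem_range, Finset.mem_Ico, zero_le, true_and] at hj ⊢
  unfold Touch dmid
  simp only [Prod.fst_sub, Prod.fst_add, Prod.snd_sub, Prod.snd_add]
  constructor
  · rintro ⟨-, h1, h2⟩; exact ⟨h1, h2⟩
  · rintro ⟨h1, h2⟩; exact ⟨by omega, h1, h2⟩

theorem touchCount_congr {x y x' y' : ℕ → ℤ} {s j : ℕ}
    (h : ∀ i < j, Touch x y i j ↔ Touch x' y' i j) : touchCount x y s j = touchCount x' y' s j := by
  unfold touchCount
  congr 1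
  exact Finset.filter_congr fun i hi => h i (Finset.mem_Ico.1 hi).2

theorem hamFn_congr {x y x' y' : ℕ → ℤ} {n : ℕ}
    (h : ∀ j < n, ∀ i < j, Touch x y i j ↔ Touch x' y' i j) : hamFn x y n = hamFn x' y' n :=
  Finset.sum_congr rfl fun j hj => touchCount_congr (h j (Finset.mem_range.1 hj))

theorem touchCount_shift (x y : ℕ → ℤ) (t j : ℕ) :
    touchCount x y t (t + j) = touchCount (fun i => x (t + i)) (fun i => y (t + i)) 0 j := by
  unfold touchCount
  symm
  refine Finset.card_bij (fun i _ => t + i) ?_ ?_ ?_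
  · intro i hi
    simp only [Finset.mem_filter, Finset.mem_Ico] at hi ⊢
    exact ⟨by omega, hi.2⟩
  · intro i _ k _ h; omega
  · intro i hi
    simp only [Finset.mem_filter, Finset.mem_Ico] at hi ⊢
    refine ⟨i - t, ⟨by omega, ?_⟩, by omega⟩
    have e : t + (i - t) = i := by omega
    have := hi.2
    unfold Touch at this ⊢
    simpa only [e, ← add_assoc] using this

theorem touchCount_split (x y : ℕ → ℤ) {s t j : ℕ} (hst : s ≤ t) (htj : t ≤ j) :
    touchCount x y s j = ((Finset.Ico s t).filter fun i => Touch x y i j).card +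
      touchCount x y t j := by
  unfold touchCount
  rw [← Finset.Ico_union_Ico_eq_Ico hst htj, Finset.filter_union, Finset.card_union_of_disjoint]
  exact Finset.disjoint_filter_filter (Finset.Ico_disjoint_Ico_consecutive _ _ _)

theorem hamFn_add (x y : ℕ → ℤ) (t m : ℕ) :
    hamFn x y (t + m) = hamFn x y t +
      (∑ j ∈ Finset.range m, ((Finset.Ico 0 t).filter fun i => Touch x y i (t + j)).card) +
      hamFn (fun i => x (t + i)) (fun i => y (t + i)) m := by
  unfold hamFn
  rw [Finset.sum_range_add, add_assoc, ← Finset.sum_add_distrib]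
  congr 1
  refine Finset.sum_congr rfl fun j _ => ?_
  rw [touchCount_split x y (Nat.zero_le t) (Nat.le_add_right t j), touchCount_shift]

namespace PrudFn

variable {N : ℕ} {x y : ℕ → ℤ}

theorem leavesBox_zero (h : PrudFn N x y) (hN : 0 < N) : LeavesBox x y 0 := by
  unfold LeavesBox Rise
  simp only [Nat.le_zero, forall_eq, Pi.neg_apply]
  have := h.step 0 hN
  omega

theorem leavesBox_sub_runPos (h : PrudFn N x y) {n : ℕ} (hn : n < N) :
    LeavesBox x y (n - runPos x y n) := by
  induction n with
  | zero => simpa [runPos] using h.leavesBox_zero hn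
  | succ n ih =>
    rw [runPos]
    split_ifs with hl
    · simpa using hl
    · rw [show n + 1 - (runPos x y n + 1) = n - runPos x y n by omega]
      exact ih (by omega)

theorem touch_of_right (h : PrudFn N x y) {i j : ℕ} (hij : i < j) (hj : j < N)
    (ht : Touch x y i j) (e : x (j + 1) = x j + 1) : i + 1 = j ∨
      (y (i + 1) = y i ∧ x i + x (i + 1) = x j + x (j + 1) ∧ (y i = y j + 1 ∨ y i = y j - 1)) := by
  have sj := h.step j hj
  have si := h.step i (by omega)
  rcases sq_add_sq_eq_four ht with ⟨ha, hb⟩ | ⟨ha, hb⟩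
  · left
    have hy : y i = y j := by omega
    have hr := h.right j hj e i hij.le hy
    by_contra hne
    by_cases hx : x i = x j
    · exact h.ne_of_lt hij hj.le hx hy
    · exact h.ne_of_lt (i := i + 1) (j := j) (by omega) hj.le (by omega) (by omega)
  · right; omega

/-- A horizontal step touches its predecessor or steps in the two adjacent rows. -/
theorem touch_of_horizontal (h : PrudFn N x y) {i j : ℕ} (hij : i < j) (hj : j < N)
    (ht : Touch x y i j) (e : y (j + 1) = y j) : i + 1 = j ∨
      (y (i + 1) = y i ∧ x i + x (i + 1) = x j + x (j + 1) ∧ (y i = y j + 1 ∨ y i = y j - 1)) := by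
  rcases h.step j hj with ⟨a, b⟩ | ⟨a, b⟩ | ⟨a, b⟩ | ⟨a, b⟩
  · exact h.touch_of_right hij hj ht a
  · have := h.negX.touch_of_right hij hj (touch_negX.2 ht) (by simp only [Pi.neg_apply]; omega)
    simp only [Pi.neg_apply] at this
    omega
  · omega
  · omega

theorem horizontal_or_vertical (h : PrudFn N x y) {j : ℕ} (hj : j < N) :
    y (j + 1) = y j ∨ x (j + 1) = x j := by
  have := h.step j hj; omega

theorem not_leavesBox_of_touch_horizontal (h : PrudFn N x y) {i j : ℕ} (hij : i + 1 < j)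
    (hj : j < N) (ht : Touch x y i j) (e : y (j + 1) = y j) : ¬ LeavesBox x y j := by
  rcases h.touch_of_horizontal (by omega) hj ht e with h0 | ⟨e1, e2, e3⟩
  · omega
  have sj := h.step j hj
  have si := h.step i (by omega)
  rintro (hr | hr | hr | hr)
  · have h1 := hr i (by omega); have h2 := hr (i + 1) (by omega); have h3 := hr j le_rfl; omega
  · have h1 := hr i (by omega); have h2 := hr (i + 1) (by omega); have h3 := hr j le_rfl
    simp only [Pi.neg_apply] at h1 h2 h3; omega
  · have := hr j le_rfl; omega
  · have := hr j le_rfl; simp only [Pi.neg_apply] at this; omega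

/-- A step leaving the bounding box touches at most its predecessor. -/
theorem not_leavesBox_of_touch (h : PrudFn N x y) {i j : ℕ} (hij : i + 1 < j) (hj : j < N)
    (ht : Touch x y i j) : ¬ LeavesBox x y j := by
  rcases h.horizontal_or_vertical hj with e | e
  · exact h.not_leavesBox_of_touch_horizontal hij hj ht e
  · rw [← leavesBox_swap]
    exact h.swap.not_leavesBox_of_touch_horizontal hij hj (touch_swap.2 ht) e

theorem touch_unique_of_horizontal (h : PrudFn N x y) {a b j : ℕ} (ha : a + 1 < j) (hb : b + 1 < j)
    (hj : j < N) (hta : Touch x y a j) (htb : Touch x y b j) (e : y (j + 1) = y j) : a = b := by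
  have hnl := h.not_leavesBox_of_touch ha hj hta
  rcases h.touch_of_horizontal (by omega) hj hta e with h0 | ⟨a1, a2, a3⟩
  · omega
  rcases h.touch_of_horizontal (by omega) hj htb e with h0 | ⟨b1, b2, b3⟩
  · omega
  simp only [LeavesBox, not_or] at hnl
  have hy : y a = y b := by
    rcases h.horizontal_step hj e with hr | hr | hr | hr
    · exact absurd hr hnl.1
    · exact absurd hr hnl.2.1
    · have h1 := hr a (by omega); have h2 := hr b (by omega); omega
    · have h1 := hr a (by omega); have h2 := hr b (by omega)
      simp only [Pi.neg_apply] at h1 h2; omega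
  have sa := h.step a (by omega)
  have sb := h.step b (by omega)
  by_cases hx : x a = x b
  · exact h.eq_of_eq (by omega) (by omega) hx hy
  · have h1 := h.eq_of_eq (i := a) (j := b + 1) (by omega) (by omega) (by omega) (by omega)
    have h2 := h.eq_of_eq (i := a + 1) (j := b) (by omega) (by omega) (by omega) (by omega)
    omega

theorem touch_unique (h : PrudFn N x y) {a b j : ℕ} (ha : a + 1 < j) (hb : b + 1 < j)
    (hj : j < N) (hta : Touch x y a j) (htb : Touch x y b j) : a = b := by
  rcases h.horizontal_or_vertical hj with e | e
  · exact h.touch_unique_of_horizontal ha hb hj hta htb e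
  · exact h.swap.touch_unique_of_horizontal ha hb hj (touch_swap.2 hta) (touch_swap.2 htb) e

theorem touchCount_le_two (h : PrudFn N x y) {j : ℕ} (hj : j < N) (s : ℕ) :
    touchCount x y s j ≤ 2 := by
  unfold touchCount
  have hsub : ((Finset.Ico s j).filter fun i => Touch x y i j) ⊆
      insert (j - 1) ((Finset.range (j - 1)).filter fun i => Touch x y i j) := by
    intro i hi
    simp only [Finset.mem_filter, Finset.mem_Ico, Finset.mem_insert, Finset.mem_range] at hi ⊢
    by_cases e : i = j - 1
    · exact .inl e
    · exact .inr ⟨by omega, hi.2⟩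
  refine (Finset.card_le_card hsub).trans ((Finset.card_insert_le _ _).trans ?_)
  have : ((Finset.range (j - 1)).filter fun i => Touch x y i j).card ≤ 1 := by
    rw [Finset.card_le_one]
    intro a ha b hb
    simp only [Finset.mem_filter, Finset.mem_range] at ha hb
    exact h.touch_unique (by omega) (by omega) hj ha.2 hb.2
  omega

theorem card_touch_le_two (h : PrudFn N x y) {j t : ℕ} (hj : j < N) (htj : t ≤ j) :
    ((Finset.Ico 0 t).filter fun i => Touch x y i j).card ≤ 2 := by
  have := touchCount_split x y (Nat.zero_le t) htj
  have := h.touchCount_le_two hj 0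
  omega

theorem hamFn_add_le (h : PrudFn N x y) {t m : ℕ} (hm : t + m ≤ N) :
    hamFn x y (t + m) ≤ hamFn x y t + 2 * m := by
  unfold hamFn
  rw [Finset.sum_range_add]
  have : ∑ j ∈ Finset.range m, touchCount x y 0 (t + j) ≤ ∑ j ∈ Finset.range m, 2 :=
    Finset.sum_le_sum fun j hj => h.touchCount_le_two
      (by have := Finset.mem_range.1 hj; omega) 0
  rw [Finset.sum_const, Finset.card_range, smul_eq_mul] at this
  omega

/-- After a step creating a new top row, the steps staying in the box run along that row. -/
theorem run_after_rise (h : PrudFn N x y) {e j : ℕ} (hej : e < j) (hj : j < N) (he : Rise y e)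
    (hn : ∀ k, e < k → k ≤ j → ¬ LeavesBox x y k) : y j = y e + 1 ∧ y (j + 1) = y j := by
  obtain ⟨m, rfl⟩ : ∃ m, j = e + 1 + m := ⟨j - e - 1, by omega⟩
  induction m with
  | zero =>
    simp only [add_zero] at *
    have h0 := he e le_rfl
    have s0 := h.step e (by omega)
    refine ⟨by omega, ?_⟩
    rcases h.step (e + 1) hj with ⟨a, b⟩ | ⟨a, b⟩ | ⟨a, b⟩ | ⟨a, b⟩
    · exact b
    · exact b
    · exfalso
      refine hn (e + 1) (by omega) le_rfl (.inr (.inr (.inl fun k hk => ?_)))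
      rcases Nat.lt_or_ge e k with hk' | hk'
      · rw [show k = e + 1 by omega]; omega
      · have := he k hk'; omega
    · have := h.down (e + 1) hj b e (by omega) (by omega); omega
  | succ m ih =>
    obtain ⟨h1, h2⟩ := ih (by omega) (by omega) fun k h1 h2 => hn k h1 (by omega)
    have h3 := h.straight_of_not_leavesBox (i := e + 1 + m) (by omega)
      (hn _ (by omega) (by omega)) (hn _ (by omega) (by omega))
    have h4 : y (e + 1 + m + 1 + 1) - y (e + 1 + m + 1) = y (e + 1 + m + 1) - y (e + 1 + m) := h3.2
    rw [show e + 1 + (m + 1) = e + 1 + m + 1 by omega]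
    omega

end PrudFn

/-! ## Touchings between the past and a piece without long runs -/

open scoped Classical in
/-- The times in `[t, t + m)` less than `T` steps after a rise of `z` from a level
already visited before time `t`. -/
noncomputable def crossSet (z : ℕ → ℤ) (t m T : ℕ) : Finset ℕ :=
  (Finset.Ico t (t + m)).filter fun j =>
    ∃ e, t ≤ e ∧ e ≤ j ∧ j < e + T ∧ Rise z e ∧ ∃ i < t, z i = z e

theorem card_crossSet_le {z : ℕ → ℤ} {t m T : ℕ}
    (hz : ∀ i, t ≤ i → i < t + m → z (i + 1) ≤ z i + 1) : (crossSet z t m T).card ≤ T := by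
  classical
  rcases (crossSet z t m T).eq_empty_or_nonempty with h0 | ⟨j₀, hj₀⟩
  · simp [h0]
  simp only [crossSet, Finset.mem_filter, Finset.mem_Ico] at hj₀
  obtain ⟨hj, e, hte, hej, hjT, hr, i, hi, hie⟩ := hj₀
  have uniq : ∀ a b : ℕ, t ≤ a → a < b → b < t + m → Rise z a → Rise z b →
      (∃ i < t, z i = z b) → False := by
    rintro a b hta hab hb ra rb ⟨i, hi, hib⟩
    have h1 := ra i (by omega)
    have h2 := rb (a + 1) (by omega)
    have h3 := hz b (by omega) hb
    omega
  have hsub : crossSet z t m T ⊆ Finset.Ico e (e + T) := by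
    intro j' hj'
    simp only [crossSet, Finset.mem_filter, Finset.mem_Ico] at hj' ⊢
    obtain ⟨hj1, e', hte', hej', hjT', hr', hex'⟩ := hj'
    have : e' = e := by
      rcases lt_trichotomy e' e with h | h | h
      · exact (uniq e' e hte' h (by omega) hr' hr ⟨i, hi, hie⟩).elim
      · exact h
      · exact (uniq e e' hte h (by omega) hr hr' hex').elim
    subst this
    omega
  simpa using Finset.card_le_card hsub

namespace PrudFn

variable {N : ℕ} {x y : ℕ → ℤ}

theorem mem_crossSet_of_rise (h : PrudFn N x y) {t m T i e j : ℕ} (hm : t + m ≤ N) (hi : i < t)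
    (hj : j < t + m) (hij : i + 1 ≠ j) (hte : t ≤ e) (hej : e < j) (hjT : j < e + T)
    (hn : ∀ k, e < k → k ≤ j → ¬ LeavesBox x y k) (ht : Touch x y i j) (hr : Rise y e) :
    j ∈ crossSet y t m T := by
  classical
  simp only [crossSet, Finset.mem_filter, Finset.mem_Ico]
  obtain ⟨h1, h2⟩ := h.run_after_rise hej (by omega) hr hn
  refine ⟨⟨by omega, hj⟩, e, hte, hej.le, hjT, hr, i, hi, ?_⟩
  rcases h.touch_of_horizontal (by omega) (by omega) ht h2 with h0 | ⟨a1, a2, a3⟩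
  · exact absurd h0 hij
  · have h3 := hr i (by omega)
    have h4 := h.step e (by omega)
    have h5 := hr e le_rfl
    omega

theorem mem_crossSet_of_touch (h : PrudFn N x y) {t m T i j : ℕ} (hm : t + m ≤ N)
    (hT : ∀ j, t ≤ j → j < t + m → runPos x y j < T) (hi : i < t) (htj : t ≤ j) (hj : j < t + m)
    (ht : Touch x y i j) : j ∈ Finset.Ico t (t + T) ∪ (crossSet x t m T ∪ crossSet (-x) t m T ∪
      (crossSet y t m T ∪ crossSet (-y) t m T)) := by
  have hr := hT j htj hj
  have hle := runPos_le x y j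
  rw [Finset.mem_union]
  by_cases hij : i + 1 = j
  · left; rw [Finset.mem_Ico]; omega
  have hnl := h.not_leavesBox_of_touch (by omega) (by omega) ht
  have hlv := h.leavesBox_sub_runPos (n := j) (by omega)
  by_cases h0 : runPos x y j = 0
  · rw [h0] at hlv; exact absurd hlv hnl
  by_cases he : j - runPos x y j < t
  · left; rw [Finset.mem_Ico]; omega
  right
  have hn : ∀ k, j - runPos x y j < k → k ≤ j → ¬ LeavesBox x y k := by
    intro k h1 h2
    have := not_leavesBox_of_lt_runPos (x := x) (y := y) (n := j) (k := j - k) (by omega)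
    rwa [show j - (j - k) = k by omega] at this
  simp only [Finset.mem_union]
  rcases hlv with hlv | hlv | hlv | hlv
  · exact .inl <| .inl <| h.swap.mem_crossSet_of_rise hm hi hj hij (by omega) (by omega)
      (by omega) (fun k h1 h2 => leavesBox_swap.not.2 (hn k h1 h2)) (touch_swap.2 ht) hlv
  · exact .inl <| .inr <| h.negX.swap.mem_crossSet_of_rise hm hi hj hij (by omega) (by omega)
      (by omega) (fun k h1 h2 => (leavesBox_swap.trans leavesBox_negX).not.2 (hn k h1 h2))
      (touch_swap.2 (touch_negX.2 ht)) hlv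
  · exact .inr <| .inl <| h.mem_crossSet_of_rise hm hi hj hij (by omega) (by omega)
      (by omega) hn ht hlv
  · exact .inr <| .inr <| h.negY.mem_crossSet_of_rise hm hi hj hij (by omega) (by omega)
      (by omega) (fun k h1 h2 => leavesBox_negY.not.2 (hn k h1 h2)) (touch_negY.2 ht) hlv

/-- The number of touchings between the past and a piece all of whose runs along the sides
of the bounding box are shorter than `T`. -/
theorem sum_card_touch_le (h : PrudFn N x y) {t m T : ℕ} (hm : t + m ≤ N)
    (hT : ∀ j, t ≤ j → j < t + m → runPos x y j < T) :
    (∑ j ∈ Finset.range m, ((Finset.Ico 0 t).filter fun i => Touch x y i (t + j)).card) ≤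
      10 * T := by
  classical
  set B := Finset.Ico t (t + T) ∪ (crossSet x t m T ∪ crossSet (-x) t m T ∪
      (crossSet y t m T ∪ crossSet (-y) t m T)) with hB
  have hBc : B.card ≤ 5 * T := by
    have c1 : (crossSet x t m T).card ≤ T := card_crossSet_le fun i h1 h2 => by
      have := h.step i (by omega); omega
    have c2 : (crossSet (-x) t m T).card ≤ T := card_crossSet_le fun i h1 h2 => by
      have := h.step i (by omega); simp only [Pi.neg_apply]; omega
    have c3 : (crossSet y t m T).card ≤ T := card_crossSet_le fun i h1 h2 => by
      have := h.step i (by omega); omega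
    have c4 : (crossSet (-y) t m T).card ≤ T := card_crossSet_le fun i h1 h2 => by
      have := h.step i (by omega); simp only [Pi.neg_apply]; omega
    have d1 := Finset.card_union_le (crossSet x t m T) (crossSet (-x) t m T)
    have d2 := Finset.card_union_le (crossSet y t m T) (crossSet (-y) t m T)
    have d3 := Finset.card_union_le (crossSet x t m T ∪ crossSet (-x) t m T)
      (crossSet y t m T ∪ crossSet (-y) t m T)
    have d4 := Finset.card_union_le (Finset.Ico t (t + T)) (crossSet x t m T ∪ crossSet (-x) t m T ∪
      (crossSet y t m T ∪ crossSet (-y) t m T))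
    rw [← hB, Nat.card_Ico] at d4
    omega
  have key : ∀ j ∈ Finset.range m, ((Finset.Ico 0 t).filter fun i => Touch x y i (t + j)).card ≤
      if t + j ∈ B then 2 else 0 := by
    intro j hj
    have hj := Finset.mem_range.1 hj
    split_ifs with hb
    · exact h.card_touch_le_two (by omega) (by omega)
    · rw [Nat.le_zero, Finset.card_eq_zero, Finset.filter_eq_empty_iff]
      intro i hi ht
      exact hb (h.mem_crossSet_of_touch hm hT (Finset.mem_Ico.1 hi).2 (by omega) (by omega) ht)
  refine (Finset.sum_le_sum key).trans ?_
  rw [← Finset.sum_filter, Finset.sum_const, smul_eq_mul]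
  have : ((Finset.range m).filter fun j => t + j ∈ B).card ≤ B.card :=
    Finset.card_le_card_of_injOn (fun j => t + j)
      (fun j hj => by simpa using (Finset.mem_filter.1 hj).2)
      (fun a _ b _ h => by simpa using h)
  omega

theorem hamFn_add_le_of_runPos_lt (h : PrudFn N x y) {t m T : ℕ} (hm : t + m ≤ N)
    (hT : ∀ j, t ≤ j → j < t + m → runPos x y j < T) :
    hamFn x y (t + m) ≤ hamFn x y t + 10 * T +
      hamFn (fun i => x (t + i)) (fun i => y (t + i)) m := by
  rw [hamFn_add]
  have := h.sum_card_touch_le hm hT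
  omega

end PrudFn

/-! ## Step lists and coordinate sequences -/

/-- Horizontal coordinate after `i` steps. -/
def px (s : List (ℤ × ℤ)) (i : ℕ) : ℤ := (pt s i).1

/-- Vertical coordinate after `i` steps. -/
def py (s : List (ℤ × ℤ)) (i : ℕ) : ℤ := (pt s i).2

/-- A list of unit steps describing a prudent path. -/
def Pru (s : List (ℤ × ℤ)) : Prop := PrudFn s.length (px s) (py s)

/-- The path always sits on the top or the right side of its bounding box. -/
def TwoSided (s : List (ℤ × ℤ)) : Prop :=
  ∀ i ≤ s.length, IsRec (px s) i ∨ IsRec (py s) i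

/-- The path ends at the upper right corner of its bounding box. -/
def EndsAtCorner (s : List (ℤ × ℤ)) : Prop :=
  IsRec (px s) s.length ∧ IsRec (py s) s.length

/-- The path makes no step down. -/
def NoDown (s : List (ℤ × ℤ)) : Prop := ∀ d ∈ s, d ≠ (0, -1)

theorem px_zero (s : List (ℤ × ℤ)) : px s 0 = 0 := by simp [px, pt]

theorem py_zero (s : List (ℤ × ℤ)) : py s 0 = 0 := by simp [py, pt]

theorem pt_succ (s : List (ℤ × ℤ)) (i : ℕ) : pt s (i + 1) = pt s i + s.getD i (0, 0) := by
  unfold pt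
  rw [List.take_add_one, List.sum_append, List.getD_eq_getElem?_getD]
  cases s[i]? <;> simp

theorem pt_append_left (a b : List (ℤ × ℤ)) {i : ℕ} (hi : i ≤ a.length) :
    pt (a ++ b) i = pt a i := by
  unfold pt; rw [List.take_append_of_le_length hi]

theorem pt_append_right (a b : List (ℤ × ℤ)) (i : ℕ) :
    pt (a ++ b) (a.length + i) = pt a a.length + pt b i := by
  unfold pt; rw [List.take_length_add_append]; simp

theorem pt_cons (d : ℤ × ℤ) (b : List (ℤ × ℤ)) (i : ℕ) : pt (d :: b) (i + 1) = d + pt b i := by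
  simp [pt]

theorem pt_take (s : List (ℤ × ℤ)) {i t : ℕ} (hi : i ≤ t) : pt (s.take t) i = pt s i := by
  unfold pt; rw [List.take_take, min_eq_left hi]

theorem pt_drop (s : List (ℤ × ℤ)) (t i : ℕ) : pt s (t + i) = pt s t + pt (s.drop t) i := by
  unfold pt; rw [List.take_add, List.sum_append]

theorem Ham_eq (s : List (ℤ × ℤ)) : Ham s = hamFn (px s) (py s) s.length := Ham_eq_hamFn s

theorem touch_translate {x y : ℕ → ℤ} (a b : ℤ) {i j : ℕ} :
    Touch (fun k => a + x k) (fun k => b + y k) i j ↔ Touch x y i j := by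
  unfold Touch
  rw [show a + x i + (a + x (i + 1)) - (a + x j + (a + x (j + 1))) =
      x i + x (i + 1) - (x j + x (j + 1)) by ring,
    show b + y i + (b + y (i + 1)) - (b + y j + (b + y (j + 1))) =
      y i + y (i + 1) - (y j + y (j + 1)) by ring]

theorem hamFn_translate (x y : ℕ → ℤ) (a b : ℤ) (n : ℕ) :
    hamFn (fun k => a + x k) (fun k => b + y k) n = hamFn x y n :=
  hamFn_congr fun _ _ _ _ => touch_translate a b

theorem hamFn_congr_coord {x y x' y' : ℕ → ℤ} {n : ℕ} (hx : ∀ i ≤ n, x i = x' i)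
    (hy : ∀ i ≤ n, y i = y' i) : hamFn x y n = hamFn x' y' n := by
  refine hamFn_congr fun j hj i hi => ?_
  unfold Touch
  rw [hx i (by omega), hx j (by omega), hx (i + 1) (by omega), hx (j + 1) (by omega),
    hy i (by omega), hy j (by omega), hy (i + 1) (by omega), hy (j + 1) (by omega)]

theorem Ham_append (a b : List (ℤ × ℤ)) :
    Ham (a ++ b) = Ham a + (∑ j ∈ Finset.range b.length, ((Finset.Ico 0 a.length).filter
      fun i => Touch (px (a ++ b)) (py (a ++ b)) i (a.length + j)).card) + Ham b := by
  rw [Ham_eq, Ham_eq, Ham_eq, List.length_append, hamFn_add]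
  congr 1
  · congr 1
    refine hamFn_congr_coord (fun i hi => ?_) fun i hi => ?_
    · simp [px, pt_append_left a b hi]
    · simp [py, pt_append_left a b hi]
  · rw [← hamFn_translate (px b) (py b) (px a a.length) (py a a.length)]
    refine hamFn_congr_coord (fun i hi => ?_) fun i hi => ?_
    · simp [px, pt_append_right a b]
    · simp [py, pt_append_right a b]

theorem Ham_add_le (a b : List (ℤ × ℤ)) : Ham a + Ham b ≤ Ham (a ++ b) := by
  rw [Ham_append]; omega

theorem Ham_le_cons (d : ℤ × ℤ) (b : List (ℤ × ℤ)) : Ham b ≤ Ham (d :: b) := by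
  have := Ham_add_le [d] b
  rw [List.singleton_append] at this
  omega

theorem Pru.Ham_append_le {a b : List (ℤ × ℤ)} (h : Pru (a ++ b)) :
    Ham (a ++ b) ≤ Ham a + 2 * b.length := by
  rw [Ham_eq, Ham_eq, List.length_append]
  have h' : PrudFn (a ++ b).length (px (a ++ b)) (py (a ++ b)) := h
  refine (h'.hamFn_add_le (by simp)).trans ?_
  rw [hamFn_congr_coord (x' := px a) (y' := py a)]
  · intro i hi; simp [px, pt_append_left a b hi]
  · intro i hi; simp [py, pt_append_left a b hi]

theorem Pru.of_append_left {a b : List (ℤ × ℤ)} (h : Pru (a ++ b)) : Pru a := by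
  have h' : PrudFn (a ++ b).length (px (a ++ b)) (py (a ++ b)) := h
  refine (h'.mono (n := a.length) (by simp)).congr ?_ ?_
  · intro i hi; simp [px, pt_append_left a b hi]
  · intro i hi; simp [py, pt_append_left a b hi]

theorem Pru.of_append_right {a b : List (ℤ × ℤ)} (h : Pru (a ++ b)) : Pru b := by
  have h' : PrudFn (a ++ b).length (px (a ++ b)) (py (a ++ b)) := h
  refine ((h'.shift (t := a.length) (m := b.length) (by simp)).translate
    (-px a a.length) (-py a a.length)).congr ?_ ?_
  · intro i hi; simp [px, pt_append_right a b i]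
  · intro i hi; simp [py, pt_append_right a b i]

theorem Pru.step_eq {s : List (ℤ × ℤ)} {i : ℕ} (hi : i < s.length) :
    s[i] = (px s (i + 1) - px s i, py s (i + 1) - py s i) := by
  have := pt_succ s i
  rw [List.getD_eq_getElem _ _ hi] at this
  simp [px, py, this]

theorem Pru.mem_cases {s : List (ℤ × ℤ)} (h : Pru s) {d : ℤ × ℤ} (hd : d ∈ s) :
    d = (1, 0) ∨ d = (-1, 0) ∨ d = (0, 1) ∨ d = (0, -1) := by
  obtain ⟨i, hi, rfl⟩ := List.getElem_of_mem hd
  have := PrudFn.step h i hi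
  rw [Pru.step_eq hi]
  simp only [Prod.mk.injEq]
  omega

theorem Pru.isPrudent {s : List (ℤ × ℤ)} (h : Pru s) : IsPrudent s := by
  intro i hi k hk j hj e
  rw [List.getD_eq_getElem _ _ hi, Pru.step_eq hi] at e
  have ex : px s i + k * (px s (i + 1) - px s i) = px s j := by
    simpa [px] using congrArg Prod.fst e
  have ey : py s i + k * (py s (i + 1) - py s i) = py s j := by
    simpa [py] using congrArg Prod.snd e
  have h' : PrudFn s.length (px s) (py s) := h
  rcases h'.step i hi with ⟨a, b⟩ | ⟨a, b⟩ | ⟨a, b⟩ | ⟨a, b⟩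
  · rw [a] at ex; rw [b] at ey; have := h'.right i hi a j hj (by linarith); ring_nf at ex; omega
  · rw [a] at ex; rw [b] at ey; have := h'.left i hi a j hj (by linarith); ring_nf at ex; omega
  · rw [a] at ex; rw [b] at ey; have := h'.up i hi b j hj (by linarith); ring_nf at ey; omega
  · rw [a] at ex; rw [b] at ey; have := h'.down i hi b j hj (by linarith); ring_nf at ey; omega

theorem IsPrudent.pru {s : List (ℤ × ℤ)} (h : IsPrudent s)
    (hs : ∀ d ∈ s, d = (1, 0) ∨ d = (-1, 0) ∨ d = (0, 1) ∨ d = (0, -1)) : Pru s := by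
  have hstep : ∀ i < s.length, (px s (i + 1) = px s i + 1 ∧ py s (i + 1) = py s i) ∨
      (px s (i + 1) = px s i - 1 ∧ py s (i + 1) = py s i) ∨
      (px s (i + 1) = px s i ∧ py s (i + 1) = py s i + 1) ∨
      (px s (i + 1) = px s i ∧ py s (i + 1) = py s i - 1) := by
    intro i hi
    have := hs _ (List.getElem_mem hi)
    rw [Pru.step_eq hi] at this
    simp only [Prod.mk.injEq] at this
    omega
  have hh : ∀ i < s.length, ∀ k : ℕ, 1 ≤ k → ∀ j ≤ i,
      ¬ (px s i + k * (px s (i + 1) - px s i) = px s j ∧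
        py s i + k * (py s (i + 1) - py s i) = py s j) := by
    intro i hi k hk j hj ⟨e1, e2⟩
    refine h i hi k hk j hj ?_
    rw [List.getD_eq_getElem _ _ hi, Pru.step_eq hi]
    refine Prod.ext ?_ ?_
    · simpa [px] using e1
    · simpa [py] using e2
  refine ⟨hstep, ?_, ?_, ?_, ?_⟩
  · intro i hi e j hj e'
    by_contra hc
    have h1 := hstep i hi
    obtain ⟨k, hk⟩ := Int.eq_ofNat_of_zero_le (a := px s j - px s i) (by omega)
    refine hh i hi k (by omega) j hj ⟨?_, ?_⟩
    · rw [e]; linarith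
    · rw [show py s (i + 1) = py s i by omega]; linarith
  · intro i hi e j hj e'
    by_contra hc
    have h1 := hstep i hi
    obtain ⟨k, hk⟩ := Int.eq_ofNat_of_zero_le (a := px s i - px s j) (by omega)
    refine hh i hi k (by omega) j hj ⟨?_, ?_⟩
    · rw [e]; linarith
    · rw [show py s (i + 1) = py s i by omega]; linarith
  · intro i hi e j hj e'
    by_contra hc
    have h1 := hstep i hi
    obtain ⟨k, hk⟩ := Int.eq_ofNat_of_zero_le (a := py s j - py s i) (by omega)
    refine hh i hi k (by omega) j hj ⟨?_, ?_⟩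
    · rw [show px s (i + 1) = px s i by omega]; linarith
    · rw [e]; linarith
  · intro i hi e j hj e'
    by_contra hc
    have h1 := hstep i hi
    obtain ⟨k, hk⟩ := Int.eq_ofNat_of_zero_le (a := py s i - py s j) (by omega)
    refine hh i hi k (by omega) j hj ⟨?_, ?_⟩
    · rw [show px s (i + 1) = px s i by omega]; linarith
    · rw [e]; linarith

/-! ## Concatenation of two-sided prudent paths -/

namespace PrudFn

variable {X Y : ℕ → ℤ} {n m : ℕ}

theorem append_up (hp : PrudFn n X Y) (hX : X (n + 1) = X n) (hY : Y (n + 1) = Y n + 1)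
    (hq : PrudFn m (fun i => X (n + 1 + i)) (fun i => Y (n + 1 + i))) (htop : IsRec Y n)
    (hlow : ∀ i ≤ m, Y (n + 1 + i) < Y (n + 1) →
      (∀ j ≤ n, X j < X (n + 1 + i)) ∧ ∀ k ≤ i, X (n + 1 + k) ≤ X (n + 1 + i))
    (hdown : ∀ i < m, Y (n + 1 + i + 1) = Y (n + 1 + i) - 1 → Y (n + 1) < Y (n + 1 + i) →
      ∀ j ≤ n, X j ≠ X (n + 1 + i)) : PrudFn (n + 1 + m) X Y := by
  have cases : ∀ i < n + 1 + m, i < n ∨ i = n ∨ ∃ k < m, i = n + 1 + k := by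
    intro i hi
    rcases lt_trichotomy i n with h | h | h
    · exact .inl h
    · exact .inr (.inl h)
    · exact .inr (.inr ⟨i - (n + 1), by omega, by omega⟩)
  have step : ∀ i < n + 1 + m, (X (i + 1) = X i + 1 ∧ Y (i + 1) = Y i) ∨
      (X (i + 1) = X i - 1 ∧ Y (i + 1) = Y i) ∨ (X (i + 1) = X i ∧ Y (i + 1) = Y i + 1) ∨
      (X (i + 1) = X i ∧ Y (i + 1) = Y i - 1) := by
    intro i hi
    rcases cases i hi with h | rfl | ⟨k, hk, rfl⟩
    · exact hp.step i h
    · omega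
    · exact hq.step k hk
  have low : ∀ k ≤ m, ∀ j ≤ n, Y j = Y (n + 1 + k) → Y (n + 1 + k) < Y (n + 1) := by
    intro k _ j hj e
    have := htop j hj
    omega
  refine ⟨step, ?_, ?_, ?_, ?_⟩
  · intro i hi e j hj e'
    rcases cases i hi with h | rfl | ⟨k, hk, rfl⟩
    · exact hp.right i h e j hj e'
    · omega
    · rcases Nat.lt_or_ge n j with h | h
      · have := hq.right k hk e (j - (n + 1)) (by omega)
        rw [show n + 1 + (j - (n + 1)) = j by omega] at this
        exact this e'
      · exact ((hlow k hk.le (low k hk.le j h e')).1 j h).le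
  · intro i hi e j hj e'
    rcases cases i hi with h | rfl | ⟨k, hk, rfl⟩
    · exact hp.left i h e j hj e'
    · omega
    · rcases Nat.lt_or_ge n j with h | h
      · have := hq.left k hk e (j - (n + 1)) (by omega)
        rw [show n + 1 + (j - (n + 1)) = j by omega] at this
        exact this e'
      · have h1 := low k hk.le j h e'
        have h2 := step _ hi
        have h3 := (hlow (k + 1) hk (by rw [← add_assoc]; omega)).2 k (by omega)
        rw [← add_assoc] at h3
        omega
  · intro i hi e j hj e'
    rcases cases i hi with h | rfl | ⟨k, hk, rfl⟩
    · exact hp.up i h e j hj e'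
    · exact htop j hj
    · rcases Nat.lt_or_ge n j with h | h
      · have := hq.up k hk e (j - (n + 1)) (by omega)
        rw [show n + 1 + (j - (n + 1)) = j by omega] at this
        exact this e'
      · by_contra hc
        have h1 := htop j h
        have h2 := (hlow k hk.le (by omega)).1 j h
        omega
  · intro i hi e j hj e'
    rcases cases i hi with h | rfl | ⟨k, hk, rfl⟩
    · exact hp.down i h e j hj e'
    · omega
    · rcases Nat.lt_or_ge n j with h | h
      · have := hq.down k hk e (j - (n + 1)) (by omega)
        rw [show n + 1 + (j - (n + 1)) = j by omega] at this
        exact this e'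
      · exfalso
        by_cases h1 : Y (n + 1) < Y (n + 1 + k)
        · exact hdown k hk e h1 j h e'
        · have h2 := step _ hi
          have h3 := (hlow (k + 1) hk (by rw [← add_assoc]; omega)).1 j h
          rw [← add_assoc] at h3
          omega

/-- A two-sided prudent path not starting with a down step stays strictly to the right of
its starting column while below its starting row. -/
theorem pos_of_twoSided {x y : ℕ → ℤ} (hq : PrudFn m x y)
    (hts : ∀ i ≤ m, IsRec x i ∨ IsRec y i) (hd : 0 < m → y 1 ≠ y 0 - 1) {i : ℕ} (hi : i ≤ m)
    (hlt : y i < y 0) : x 0 < x i := by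
  induction i with
  | zero => omega
  | succ i ih =>
    have hrec : IsRec x (i + 1) := by
      rcases hts (i + 1) hi with h | h
      · exact h
      · have := h 0 (by omega); omega
    have h0 := hrec 0 (by omega)
    have h1 := hrec i (by omega)
    by_contra hc
    by_cases h2 : y i < y 0
    · have := ih (by omega) h2; omega
    · have h3 := hq.step i (by omega)
      have h4 : i = 0 := hq.eq_of_eq (by omega) (by omega) (by omega) (by omega)
      subst h4
      exact hd (by omega) (by simp only [zero_add] at *; omega)

theorem append_corner (hp : PrudFn n X Y) (hX : X (n + 1) = X n) (hY : Y (n + 1) = Y n + 1)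
    (hq : PrudFn m (fun i => X (n + 1 + i)) (fun i => Y (n + 1 + i)))
    (hright : IsRec X n) (htop : IsRec Y n)
    (hts : ∀ i ≤ m, IsRec (fun i => X (n + 1 + i)) i ∨ IsRec (fun i => Y (n + 1 + i)) i)
    (hd : 0 < m → Y (n + 2) ≠ Y (n + 1) - 1) : PrudFn (n + 1 + m) X Y := by
  refine hp.append_up hX hY hq htop (fun i hi hlt => ⟨fun j hj => ?_, ?_⟩)
    fun i hi e hlt j hj e' => ?_
  · have h1 := hq.pos_of_twoSided hts hd hi hlt
    have h2 := hright j hj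
    simp only [add_zero] at h1
    omega
  · rcases hts i hi with h | h
    · exact h
    · have := h 0 (by omega)
      simp only [add_zero] at this
      omega
  · have h1 : IsRec (fun i => X (n + 1 + i)) (i + 1) := by
      rcases hts (i + 1) hi with h | h
      · exact h
      · have := h i (by omega)
        simp only [← add_assoc] at this
        omega
    have h2 := h1 0 (by omega)
    simp only [add_zero, ← add_assoc] at h2
    have h3 := hright j hj
    have h5 := hq.step i hi
    have h4 := hq.down i hi e 0 (by omega)
    simp only [add_zero, ← add_assoc] at h4 h5
    have := h4 (by omega)
    omega

theorem append_noDown (hp : PrudFn n X Y) (hX : X (n + 1) = X n) (hY : Y (n + 1) = Y n + 1)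
    (hq : PrudFn m (fun i => X (n + 1 + i)) (fun i => Y (n + 1 + i))) (htop : IsRec Y n)
    (hup : ∀ i < m, Y (n + 1 + i) ≤ Y (n + 1 + i + 1)) : PrudFn (n + 1 + m) X Y := by
  have hge : ∀ i ≤ m, Y (n + 1) ≤ Y (n + 1 + i) := by
    intro i hi
    induction i with
    | zero => simp
    | succ i ih =>
      have := hup i hi
      have := ih (by omega)
      rw [← add_assoc]
      omega
  refine hp.append_up hX hY hq htop (fun i hi hlt => ?_) fun i hi e hlt => ?_
  · have := hge i hi; omega
  · have := hup i hi; omega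

end PrudFn

section append

variable {p q : List (ℤ × ℤ)}

theorem px_append_left (p q : List (ℤ × ℤ)) {i : ℕ} (hi : i ≤ p.length) :
    px (p ++ q) i = px p i := by
  simp [px, pt_append_left p q hi]

theorem py_append_left (p q : List (ℤ × ℤ)) {i : ℕ} (hi : i ≤ p.length) :
    py (p ++ q) i = py p i := by
  simp [py, pt_append_left p q hi]

theorem px_append_up (p q : List (ℤ × ℤ)) (i : ℕ) :
    px (p ++ (0, 1) :: q) (p.length + 1 + i) = px p p.length + px q i := by
  rw [add_assoc, add_comm 1 i]
  simp [px, pt_append_right, pt_cons]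

theorem py_append_up (p q : List (ℤ × ℤ)) (i : ℕ) :
    py (p ++ (0, 1) :: q) (p.length + 1 + i) = py p p.length + 1 + py q i := by
  rw [add_assoc, add_comm 1 i]
  simp [py, pt_append_right, pt_cons, add_assoc]

theorem length_append_up (p q : List (ℤ × ℤ)) :
    (p ++ (0, 1) :: q).length = p.length + 1 + q.length := by
  simp; omega

theorem isRec_congr {x x' : ℕ → ℤ} {n : ℕ} (h : ∀ i ≤ n, x i = x' i) : IsRec x n ↔ IsRec x' n := by
  unfold IsRec
  refine forall₂_congr fun j hj => ?_
  rw [h j hj, h n le_rfl]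

theorem isRec_add_left {x : ℕ → ℤ} {a : ℤ} {n : ℕ} : IsRec (fun i => a + x i) n ↔ IsRec x n := by
  simp [IsRec]

theorem NoDown.py_le (h : NoDown q) (hq : Pru q) {i : ℕ} (hi : i < q.length) :
    py q i ≤ py q (i + 1) := by
  have := h _ (List.getElem_mem hi)
  rw [Pru.step_eq hi] at this
  have h2 := PrudFn.step hq i hi
  by_contra hc
  refine this (Prod.ext ?_ ?_) <;> dsimp only <;> omega

theorem NoDown.isRec (h : NoDown q) (hq : Pru q) {i : ℕ} (hi : i ≤ q.length) : IsRec (py q) i := by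
  induction i with
  | zero => intro j hj; rw [Nat.le_zero.1 hj]
  | succ i ih =>
    intro j hj
    rcases Nat.lt_or_ge i j with h1 | h1
    · rw [show j = i + 1 by omega]
    · exact (ih (by omega) j h1).trans (h.py_le hq hi)

theorem NoDown.twoSided (h : NoDown q) (hq : Pru q) : TwoSided q := fun _ hi =>
  .inr (h.isRec hq hi)

theorem NoDown.append_up (hp : NoDown p) (hq : NoDown q) : NoDown (p ++ (0, 1) :: q) := by
  intro d hd
  rw [List.mem_append, List.mem_cons] at hd
  rcases hd with h | rfl | h
  · exact hp d h
  · simp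
  · exact hq d h

theorem isRec_px_append_up (hright : IsRec (px p) p.length) {i : ℕ}
    (h : IsRec (px q) i) : IsRec (px (p ++ (0, 1) :: q)) (p.length + 1 + i) := by
  intro j hj
  have h0 := h 0 (by omega)
  rw [px_zero] at h0
  rw [px_append_up]
  rcases Nat.lt_or_ge p.length j with h1 | h1
  · obtain ⟨k, rfl⟩ : ∃ k, j = p.length + 1 + k := ⟨j - (p.length + 1), by omega⟩
    rw [px_append_up]
    have := h k (by omega)
    omega
  · rw [px_append_left _ _ h1]
    have := hright j h1
    omega

theorem isRec_py_append_up (htop : IsRec (py p) p.length) {i : ℕ}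
    (h : IsRec (py q) i) : IsRec (py (p ++ (0, 1) :: q)) (p.length + 1 + i) := by
  intro j hj
  have h0 := h 0 (by omega)
  rw [py_zero] at h0
  rw [py_append_up]
  rcases Nat.lt_or_ge p.length j with h1 | h1
  · obtain ⟨k, rfl⟩ : ∃ k, j = p.length + 1 + k := ⟨j - (p.length + 1), by omega⟩
    rw [py_append_up]
    have := h k (by omega)
    omega
  · rw [py_append_left _ _ h1]
    have := htop j h1
    omega

theorem TwoSided.append_up (hp : TwoSided p) (hcp : IsRec (py p) p.length)
    (h : ∀ i ≤ q.length, (IsRec (px p) p.length ∧ IsRec (px q) i) ∨ IsRec (py q) i) :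
    TwoSided (p ++ (0, 1) :: q) := by
  intro i hi
  rw [length_append_up] at hi
  rcases Nat.lt_or_ge p.length i with h1 | h1
  · obtain ⟨k, rfl⟩ : ∃ k, i = p.length + 1 + k := ⟨i - (p.length + 1), by omega⟩
    rcases h k (by omega) with ⟨h2, h3⟩ | h2
    · exact .inl (isRec_px_append_up h2 h3)
    · exact .inr (isRec_py_append_up hcp h2)
  · rw [isRec_congr (x' := px p) fun j hj => px_append_left _ _ (by omega),
      isRec_congr (x' := py p) fun j hj => py_append_left _ _ (by omega)]
    exact hp i h1

theorem EndsAtCorner.append_up (hp : EndsAtCorner p) (hq : EndsAtCorner q) :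
    EndsAtCorner (p ++ (0, 1) :: q) := by
  unfold EndsAtCorner
  rw [length_append_up]
  exact ⟨isRec_px_append_up hp.1 hq.1, isRec_py_append_up hp.2 hq.2⟩

theorem pru_append_up_pieces (hp : Pru p) (hq : Pru q) :
    PrudFn p.length (px (p ++ (0, 1) :: q)) (py (p ++ (0, 1) :: q)) ∧
    px (p ++ (0, 1) :: q) (p.length + 1) = px (p ++ (0, 1) :: q) p.length ∧
    py (p ++ (0, 1) :: q) (p.length + 1) = py (p ++ (0, 1) :: q) p.length + 1 ∧
    PrudFn q.length (fun i => px (p ++ (0, 1) :: q) (p.length + 1 + i))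
      (fun i => py (p ++ (0, 1) :: q) (p.length + 1 + i)) := by
  have hx := px_append_up p q 0
  have hy := py_append_up p q 0
  rw [px_zero, add_zero, add_zero] at hx
  rw [py_zero, add_zero, add_zero] at hy
  refine ⟨PrudFn.congr hp (fun i hi => px_append_left _ _ hi) fun i hi => py_append_left _ _ hi,
    ?_, ?_, ?_⟩
  · rw [hx, px_append_left _ _ le_rfl]
  · rw [hy, py_append_left _ _ le_rfl]
  · refine (PrudFn.translate hq (px p p.length) (py p p.length + 1)).congr
      (fun i _ => ?_) fun i _ => ?_
    · rw [px_append_up, add_comm]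
    · rw [py_append_up, add_comm]

theorem Pru.append_noDown (hp : Pru p) (htop : IsRec (py p) p.length) (hq : Pru q)
    (hd : NoDown q) : Pru (p ++ (0, 1) :: q) := by
  obtain ⟨h1, h2, h3, h4⟩ := pru_append_up_pieces hp hq
  unfold Pru
  rw [length_append_up]
  refine h1.append_noDown h2 h3 h4 ?_ fun i hi => ?_
  · rwa [isRec_congr (x' := py p) fun j hj => py_append_left _ _ hj]
  · rw [add_assoc _ i 1, py_append_up, py_append_up]
    have := hd.py_le hq hi
    omega

theorem Pru.append_corner (hp : Pru p) (hc : EndsAtCorner p) (hq : Pru q)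
    (hts : TwoSided q) (hd : q.head? ≠ some (0, -1)) : Pru (p ++ (0, 1) :: q) := by
  obtain ⟨h1, h2, h3, h4⟩ := pru_append_up_pieces hp hq
  unfold Pru
  rw [length_append_up]
  refine h1.append_corner h2 h3 h4 ?_ ?_ ?_ ?_
  · rw [isRec_congr (x' := px p) fun j hj => px_append_left _ _ hj]; exact hc.1
  · rw [isRec_congr (x' := py p) fun j hj => py_append_left _ _ hj]; exact hc.2
  · simp only [px_append_up, py_append_up, isRec_add_left]
    exact hts
  · intro hm e
    have e0 := py_append_up p q 0
    have e1 := py_append_up p q 1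
    rw [add_zero] at e0
    rw [add_assoc p.length 1 1] at e1
    norm_num at e1
    have h5 := PrudFn.step hq 0 hm
    refine hd ?_
    rw [List.head?_eq_getElem?, List.getElem?_eq_getElem hm, Pru.step_eq hm]
    simp only [Option.some.injEq, Prod.mk.injEq]
    simp only [zero_add] at h5 ⊢
    omega

end append

/-! ## Two-sided prudent paths are NE-prudent -/

/-- A block decomposition of `s` whose last block has type `b'`. -/
def NERep (b' : Bool) (s : List (ℤ × ℤ)) : Prop :=
  ∃ (b : Bool) (bs : List (List ℤ)) (ls : List ℤ), Bool.not^[bs.length] b = b' ∧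
    IsNEData (bs ++ [ls]) ∧ neSteps b (bs ++ [ls]) = s

theorem neSteps_append (b : Bool) (l₁ l₂ : List (List ℤ)) :
    neSteps b (l₁ ++ l₂) = neSteps b l₁ ++ neSteps (Bool.not^[l₁.length] b) l₂ := by
  induction l₁ generalizing b with
  | nil => simp [neSteps]
  | cons a l ih => simp [neSteps, ih]

theorem hrun_eq_map_swap (ℓ : ℤ) : hrun ℓ = (vrun ℓ).map Prod.swap := by
  unfold hrun vrun; split_ifs <;> simp

theorem snSteps_eq_map_swap (ls : List ℤ) : snSteps ls = (weSteps ls).map Prod.swap := by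
  have : ls.map hrun = (ls.map vrun).map (List.map Prod.swap) := by
    simp [Function.comp_def, hrun_eq_map_swap]
  unfold snSteps weSteps List.intercalate
  rw [this, List.map_flatten]
  congr 1
  induction ls.map vrun with
  | nil => rfl
  | cons a l ih =>
    cases l with
    | nil => rfl
    | cons b l => simpa using ih

theorem weSteps_eq_map_swap (ls : List ℤ) : weSteps ls = (snSteps ls).map Prod.swap := by
  rw [snSteps_eq_map_swap]; simp

theorem blockSteps_not (b : Bool) (ls : List ℤ) :
    blockSteps (!b) ls = (blockSteps b ls).map Prod.swap := by
  cases b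
  · exact weSteps_eq_map_swap ls
  · exact snSteps_eq_map_swap ls

theorem neSteps_not (b : Bool) (bs : List (List ℤ)) :
    neSteps (!b) bs = (neSteps b bs).map Prod.swap := by
  induction bs generalizing b with
  | nil => simp [neSteps]
  | cons a l ih => rw [neSteps, neSteps, blockSteps_not, ih, List.map_append]

theorem not_iterate_not (n : ℕ) (b : Bool) : Bool.not^[n] (!b) = !(Bool.not^[n] b) := by
  rw [← Function.iterate_succ_apply, Function.iterate_succ_apply']

theorem NERep.swap {b' : Bool} {s : List (ℤ × ℤ)} (h : NERep b' s) :
    NERep (!b') (s.map Prod.swap) := by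
  obtain ⟨b, bs, ls, rfl, h2, rfl⟩ := h
  exact ⟨!b, bs, ls, not_iterate_not _ _, h2, neSteps_not _ _⟩

/-- The west-east path with stretch sequence `ls`, followed by an inter-stretch. -/
def weInit (ls : List ℤ) : List (ℤ × ℤ) := (ls.map fun ℓ => vrun ℓ ++ [(1, 0)]).flatten

theorem weSteps_append_singleton (ls : List ℤ) (ℓ : ℤ) :
    weSteps (ls ++ [ℓ]) = weInit ls ++ vrun ℓ := by
  induction ls with
  | nil => simp [weSteps, weInit, List.intercalate]
  | cons a l ih =>
    have hne : (l ++ [ℓ]).map vrun ≠ [] := by simp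
    unfold weSteps at ih ⊢
    rw [List.cons_append, List.map_cons, List.intercalate_cons_of_ne_nil hne, ih]
    simp [weInit]

theorem weInit_append (l₁ l₂ : List ℤ) : weInit (l₁ ++ l₂) = weInit l₁ ++ weInit l₂ := by
  simp [weInit]

theorem sum_vrun (ℓ : ℤ) : (vrun ℓ).sum = (0, ℓ) := by
  unfold vrun
  rw [List.sum_replicate]
  split_ifs with h
  · simp [abs_of_nonneg h]
  · simp [abs_of_neg (not_le.1 h)]

theorem sum_weInit (ls : List ℤ) : (weInit ls).sum = ((ls.length : ℤ), ls.sum) := by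
  induction ls with
  | nil => rfl
  | cons a l ih =>
    have : weInit (a :: l) = vrun a ++ [(1, 0)] ++ weInit l := by simp [weInit]
    rw [this, List.sum_append, List.sum_append, sum_vrun, ih]
    simp [add_comm]

theorem vrun_add_one {ℓ : ℤ} (h : 0 ≤ ℓ) : vrun (ℓ + 1) = vrun ℓ ++ [(0, 1)] := by
  unfold vrun
  rw [if_pos h, if_pos (by omega), show (ℓ + 1).natAbs = ℓ.natAbs + 1 by omega,
    List.replicate_succ']

theorem vrun_sub_one {ℓ : ℤ} (h : ℓ ≤ 0) : vrun (ℓ - 1) = vrun ℓ ++ [(0, -1)] := by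
  rcases h.lt_or_eq with h | rfl
  · unfold vrun
    rw [if_neg (by omega), if_neg (by omega), show (ℓ - 1).natAbs = ℓ.natAbs + 1 by omega,
      List.replicate_succ']
  · rfl

/-- A prudent path has no immediate reversal. -/
theorem Pru.not_reversal {s : List (ℤ × ℤ)} {d e : ℤ × ℤ} (h : Pru (s ++ [d] ++ [e])) :
    d + e ≠ 0 := by
  intro h0
  have h1 : pt (s ++ [d] ++ [e]) s.length = pt (s ++ [d] ++ [e]) (s.length + 2) := by
    rw [List.append_assoc, pt_append_left _ _ le_rfl, pt_append_right]
    simp [pt, h0]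
  have := PrudFn.eq_of_eq h (i := s.length) (j := s.length + 2) (by simp) (by simp)
    (congrArg Prod.fst h1) (congrArg Prod.snd h1)
  omega

theorem isNEData_append_singleton {bs : List (List ℤ)} {ls : List ℤ} :
    IsNEData (bs ++ [ls]) ↔ (∀ l ∈ bs, l ≠ []) ∧ ls ≠ [] ∧ (∀ l ∈ bs, upperExit l) ∧
      (∀ i : ℕ, 0 < i → i < bs.length → (bs.getD i []).headI < 0) ∧ (bs ≠ [] → ls.headI < 0) := by
  have hg : ∀ i < bs.length, (bs ++ [ls]).getD i [] = bs.getD i [] := fun i hi => by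
    simp [List.getElem?_append_left hi]
  have hl : (bs ++ [ls]).getD bs.length [] = ls := by simp
  unfold IsNEData
  constructor
  · rintro ⟨-, h1, h2, h3⟩
    refine ⟨fun l hl => h1 l (by simp [hl]), h1 ls (by simp), ?_, ?_, ?_⟩
    · intro l hl
      obtain ⟨i, hi, rfl⟩ := List.getElem_of_mem hl
      have := h2 i (by simpa using hi)
      rwa [hg i hi, List.getD_eq_getElem _ _ hi] at this
    · intro i h0 hi
      have := h3 i h0 (by simp; omega)
      rwa [hg i hi] at this
    · intro hne
      have := h3 bs.length (List.length_pos_iff.2 hne) (by simp)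
      rwa [hl] at this
  · rintro ⟨h1, h2, h3, h4, h5⟩
    refine ⟨by simp, ?_, ?_, ?_⟩
    · intro l hl
      rcases List.mem_append.1 hl with h | h
      · exact h1 l h
      · rw [List.mem_singleton.1 h]; exact h2
    · intro i hi
      have hi : i < bs.length := by simpa using hi
      rw [hg i hi, List.getD_eq_getElem _ _ hi]
      exact h3 _ (List.getElem_mem hi)
    · intro i h0 hi
      rcases Nat.lt_or_ge i bs.length with h | h
      · rw [hg i h]; exact h4 i h0 h
      · have : i = bs.length := by simp at hi; omega
        subst this
        rw [hl]
        exact h5 (List.length_pos_iff.1 h0)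

theorem pt_map_swap (s : List (ℤ × ℤ)) (i : ℕ) : pt (s.map Prod.swap) i = (pt s i).swap := by
  unfold pt
  rw [← List.map_take]
  induction s.take i with
  | nil => rfl
  | cons a l ih => simp [ih]

theorem Pru.swap {s : List (ℤ × ℤ)} (h : Pru s) : Pru (s.map Prod.swap) := by
  unfold Pru
  rw [List.length_map]
  exact (PrudFn.swap h).congr (fun i _ => by simp [px, py, pt_map_swap])
    fun i _ => by simp [px, py, pt_map_swap]

theorem TwoSided.swap {s : List (ℤ × ℤ)} (h : TwoSided s) : TwoSided (s.map Prod.swap) := by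
  intro i hi
  rw [List.length_map] at hi
  rw [isRec_congr (x := px (s.map Prod.swap)) (x' := py s) fun i _ => by simp [px, py, pt_map_swap],
    isRec_congr (x := py (s.map Prod.swap)) (x' := px s) fun i _ => by simp [px, py, pt_map_swap]]
  exact (h i hi).symm

theorem sum_eq_pt (s : List (ℤ × ℤ)) : pt s s.length = s.sum := by simp [pt]

theorem NERep.left_step {b : Bool} {bs : List (List ℤ)} {ls : List ℤ} {ℓ : ℤ}
    (hb : Bool.not^[bs.length] b = true) (hd : IsNEData (bs ++ [ls ++ [ℓ]]))
    (hne : neSteps b bs ++ (weInit ls ++ vrun ℓ) ≠ [])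
    (h : Pru (neSteps b bs ++ (weInit ls ++ vrun ℓ) ++ [(-1, 0)]))
    (ht : TwoSided (neSteps b bs ++ (weInit ls ++ vrun ℓ) ++ [(-1, 0)])) :
    NERep false (neSteps b bs ++ (weInit ls ++ vrun ℓ) ++ [(-1, 0)]) := by
  rw [isNEData_append_singleton] at hd
  obtain ⟨d1, d2, d3, d4, d5⟩ := hd
  set s := neSteps b bs ++ (weInit ls ++ vrun ℓ) with hs
  refine ⟨b, bs ++ [ls ++ [ℓ]], [-1], ?_, ?_, ?_⟩
  · rw [List.length_append, List.length_singleton, Function.iterate_succ_apply', hb]; rfl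
  · have hsum : ∀ i ≤ ls.length, ∃ j ≤ s.length,
        pt (s ++ [(-1, 0)]) j = (neSteps b bs).sum + ((i : ℤ), ((ls ++ [ℓ]).take i).sum) := by
      intro i hi
      have e1 : ls = ls.take i ++ ls.drop i := (List.take_append_drop i ls).symm
      have e2 : weInit ls = weInit (ls.take i) ++ weInit (ls.drop i) := by
        rw [← weInit_append, ← e1]
      have e3 : s ++ [(-1, 0)] = (neSteps b bs ++ weInit (ls.take i)) ++
          (weInit (ls.drop i) ++ vrun ℓ ++ [(-1, 0)]) := by
        rw [hs, e2]; simp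
      refine ⟨(neSteps b bs ++ weInit (ls.take i)).length, ?_, ?_⟩
      · rw [hs, e2]; simp
      · rw [e3, pt_append_left _ _ le_rfl, sum_eq_pt, List.sum_append, sum_weInit,
          List.take_append_of_le_length hi, List.length_take, min_eq_left hi]
    have hend : pt (s ++ [(-1, 0)]) s.length =
        (neSteps b bs).sum + ((ls.length : ℤ), (ls ++ [ℓ]).sum) := by
      rw [pt_append_left _ _ le_rfl, sum_eq_pt, hs, List.sum_append, List.sum_append, sum_weInit,
        sum_vrun]
      simp
    have hlast : pt (s ++ [(-1, 0)]) (s.length + 1) = pt (s ++ [(-1, 0)]) s.length + (-1, 0) := by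
      rw [pt_succ]; simp
    have hlx : px (s ++ [(-1, 0)]) (s.length + 1) = px (s ++ [(-1, 0)]) s.length - 1 := by
      simp [px, hlast]; rfl
    have hly : py (s ++ [(-1, 0)]) (s.length + 1) = py (s ++ [(-1, 0)]) s.length := by
      simp [py, hlast]
    have hrec : ∀ j ≤ s.length, py (s ++ [(-1, 0)]) j ≤ py (s ++ [(-1, 0)]) s.length := by
      intro j hj
      rcases ht (s.length + 1) (by simp) with h1 | h1
      · have := h1 s.length (by omega); omega
      · have := h1 j (by omega); omega
    have hℓ : ℓ ≠ 0 := by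
      rintro rfl
      rcases List.eq_nil_or_concat ls with rfl | ⟨l', a, rfl⟩
      · by_cases hbs : bs = []
        · subst hbs; exact hne (by simp [hs, neSteps, weInit, vrun])
        · have := d5 hbs; simp at this
      · have : s ++ [(-1, 0)] = (neSteps b bs ++ weInit l' ++ vrun a) ++ [(1, 0)] ++ [(-1, 0)] := by
          simp [hs, weInit, vrun]
        rw [this] at h
        exact h.not_reversal (by simp)
    have hexit : upperExit (ls ++ [ℓ]) := by
      intro i hi
      have hi : i ≤ ls.length := by simp at hi; omega
      obtain ⟨j, hj, hpt⟩ := hsum i hi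
      have hy := hrec j hj
      have hle : ((ls ++ [ℓ]).take i).sum ≤ (ls ++ [ℓ]).sum := by
        simpa [py, hpt, hend] using hy
      refine lt_of_le_of_ne hle fun heq => ?_
      have hl := PrudFn.left h s.length (by simp) hlx j hj (by simp [py, hpt, hend, heq])
      have : i = ls.length := by
        simp [px, hpt, hend] at hl; omega
      subst this
      simp at heq
      exact hℓ heq
    rw [isNEData_append_singleton]
    refine ⟨?_, by simp, ?_, ?_, by simp⟩
    · intro l hl
      rcases List.mem_append.1 hl with hl | hl
      · exact d1 l hl
      · rw [List.mem_singleton.1 hl]; exact d2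
    · intro l hl
      rcases List.mem_append.1 hl with hl | hl
      · exact d3 l hl
      · rw [List.mem_singleton.1 hl]; exact hexit
    · intro i h0 hi
      rcases Nat.lt_or_ge i bs.length with h | h
      · have := d4 i h0 h
        rwa [List.getD_append _ _ _ _ h]
      · have : i = bs.length := by simp at hi; omega
        subst this
        simpa using d5 (List.length_pos_iff.1 h0)
  · rw [neSteps_append, neSteps_append, List.length_append, List.length_singleton,
      Function.iterate_succ_apply', hb]
    simp only [neSteps, blockSteps, Bool.not_true]
    rw [weSteps_append_singleton, List.append_nil, List.append_nil, hs]
    simp [snSteps, hrun, List.intercalate]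

theorem NERep.append_step {s : List (ℤ × ℤ)} {d : ℤ × ℤ} (hr : NERep true s)
    (h : Pru (s ++ [d])) (ht : TwoSided (s ++ [d])) : ∃ b, NERep b (s ++ [d]) := by
  obtain ⟨b, bs, ls, hb, hd, hs⟩ := hr
  have hd' := hd
  rw [isNEData_append_singleton] at hd
  obtain ⟨d1, d2, d3, d4, d5⟩ := hd
  obtain ⟨l, ℓ, rfl⟩ : ∃ l ℓ, ls = l ++ [ℓ] := by
    rcases List.eq_nil_or_concat ls with h | ⟨l, a, h⟩
    · exact absurd h d2
    · exact ⟨l, a, by simpa using h⟩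
  have hrep : ∀ l ℓ, neSteps b (bs ++ [l ++ [ℓ]]) = neSteps b bs ++ (weInit l ++ vrun ℓ) := by
    intro l ℓ
    rw [neSteps_append, hb]
    simp [neSteps, blockSteps, weSteps_append_singleton]
  rw [hrep] at hs
  rcases h.mem_cases (d := d) (by simp) with rfl | rfl | rfl | rfl
  · refine ⟨true, b, bs, (l ++ [ℓ]) ++ [0], hb, ?_, ?_⟩
    · rw [isNEData_append_singleton]
      refine ⟨d1, by simp, d3, d4, fun hbs => ?_⟩
      have := d5 hbs
      cases l <;> simpa using this
    · rw [hrep, ← hs]; simp [weInit, vrun]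
  · by_cases hne : s = []
    · subst hne
      refine ⟨false, false, [], [-1], rfl, ?_, ?_⟩
      · rw [isNEData_append_singleton]; simp
      · simp [neSteps, blockSteps, snSteps, hrun, List.intercalate]
    · rw [← hs] at h ht hne ⊢
      exact ⟨false, NERep.left_step hb hd' hne h ht⟩
  · have h0 : 0 ≤ ℓ := by
      by_contra hc
      have e : vrun ℓ = vrun (ℓ + 1) ++ [(0, -1)] := by
        rw [← vrun_sub_one (by omega)]; simp
      rw [← hs, e, ← List.append_assoc, ← List.append_assoc] at h
      exact h.not_reversal (by simp)
    refine ⟨true, b, bs, l ++ [ℓ + 1], hb, ?_, ?_⟩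
    · rw [isNEData_append_singleton]
      refine ⟨d1, by simp, d3, d4, fun hbs => ?_⟩
      have := d5 hbs
      cases l
      · simp at this; omega
      · simpa using this
    · rw [hrep, ← hs, vrun_add_one h0]; simp
  · have h0 : ℓ ≤ 0 := by
      by_contra hc
      have e : vrun ℓ = vrun (ℓ - 1) ++ [(0, 1)] := by
        rw [← vrun_add_one (by omega)]; simp
      rw [← hs, e, ← List.append_assoc, ← List.append_assoc] at h
      exact h.not_reversal (by simp)
    refine ⟨true, b, bs, l ++ [ℓ - 1], hb, ?_, ?_⟩
    · rw [isNEData_append_singleton]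
      refine ⟨d1, by simp, d3, d4, fun hbs => ?_⟩
      have := d5 hbs
      cases l
      · simp; omega
      · simpa using this
    · rw [hrep, ← hs, vrun_sub_one h0]; simp

theorem TwoSided.of_append_left {a b : List (ℤ × ℤ)} (h : TwoSided (a ++ b)) : TwoSided a := by
  intro i hi
  have := h i (by simp; omega)
  rwa [isRec_congr (x' := px a) fun j hj => px_append_left _ _ (by omega),
      isRec_congr (x' := py a) fun j hj => py_append_left _ _ (by omega)] at this

theorem Pru.exists_neRep {s : List (ℤ × ℤ)} (h : Pru s) (ht : TwoSided s) : ∃ b, NERep b s := by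
  induction s using List.reverseRecOn with
  | nil =>
    refine ⟨true, true, [], [0], rfl, ?_, ?_⟩
    · rw [isNEData_append_singleton]; simp
    · simp [neSteps, blockSteps, weSteps, vrun, List.intercalate]
  | append_singleton s d ih =>
    obtain ⟨b, hb⟩ := ih h.of_append_left ht.of_append_left
    cases b
    · have h1 := h.swap
      have h2 := ht.swap
      rw [List.map_append, List.map_singleton] at h1 h2
      obtain ⟨b, hb'⟩ := hb.swap.append_step h1 h2
      refine ⟨!b, ?_⟩
      have := hb'.swap
      simpa using this
    · exact hb.append_step h ht

/-- A prudent path staying on the top and right sides of its bounding box is NE-prudent. -/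
theorem Pru.isNEPath {s : List (ℤ × ℤ)} (h : Pru s) (ht : TwoSided s) : IsNEPath s := by
  obtain ⟨_, b, bs, ls, -, h1, h2⟩ := h.exists_neRep ht
  exact ⟨h.isPrudent, b, bs ++ [ls], h1, h2⟩

/-! ## Symmetries of the square lattice -/

/-- The symmetries of `ℤ²` fixing the origin: an optional swap of the coordinates followed by
optional reflections of each coordinate. -/
def act (g : Bool × Bool × Bool) (d : ℤ × ℤ) : ℤ × ℤ :=
  let e := if g.1 then d.swap else d
  (if g.2.1 then -e.1 else e.1, if g.2.2 then -e.2 else e.2)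

/-- The inverse symmetry. -/
def actInv (g : Bool × Bool × Bool) : Bool × Bool × Bool :=
  if g.1 then (true, g.2.2, g.2.1) else g

theorem act_actInv (g : Bool × Bool × Bool) (d : ℤ × ℤ) : act (actInv g) (act g d) = d := by
  obtain ⟨a, b, c⟩ := g
  cases a <;> cases b <;> cases c <;> simp [act, actInv]

theorem act_zero (g : Bool × Bool × Bool) : act g 0 = 0 := by
  obtain ⟨a, b, c⟩ := g
  cases a <;> cases b <;> cases c <;> rfl

theorem act_add (g : Bool × Bool × Bool) (d e : ℤ × ℤ) : act g (d + e) = act g d + act g e := by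
  obtain ⟨a, b, c⟩ := g
  refine Prod.ext ?_ ?_ <;> cases a <;> cases b <;> cases c <;> simp [act, add_comm]

theorem map_actInv (g : Bool × Bool × Bool) (s : List (ℤ × ℤ)) :
    (s.map (act g)).map (act (actInv g)) = s := by
  rw [List.map_map, show act (actInv g) ∘ act g = id from funext (act_actInv g), List.map_id]

theorem pt_map_act (g : Bool × Bool × Bool) (s : List (ℤ × ℤ)) (i : ℕ) :
    pt (s.map (act g)) i = act g (pt s i) := by
  unfold pt
  rw [← List.map_take]
  induction s.take i with
  | nil => simp [act_zero]
  | cons a l ih => simp [ih, act_add]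

theorem px_map_act (g : Bool × Bool × Bool) (s : List (ℤ × ℤ)) (i : ℕ) :
    px (s.map (act g)) i = (if g.2.1 then -1 else 1) * (if g.1 then py s i else px s i) := by
  rw [px, pt_map_act]
  obtain ⟨a, b, c⟩ := g
  cases a <;> cases b <;> cases c <;> simp [act, px, py]

theorem py_map_act (g : Bool × Bool × Bool) (s : List (ℤ × ℤ)) (i : ℕ) :
    py (s.map (act g)) i = (if g.2.2 then -1 else 1) * (if g.1 then px s i else py s i) := by
  rw [py, pt_map_act]
  obtain ⟨a, b, c⟩ := g
  cases a <;> cases b <;> cases c <;> simp [act, px, py]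

theorem Pru.map_act {s : List (ℤ × ℤ)} (h : Pru s) (g : Bool × Bool × Bool) :
    Pru (s.map (act g)) := by
  have h' : PrudFn s.length (px s) (py s) := h
  unfold Pru
  rw [List.length_map]
  obtain ⟨a, b, c⟩ := g
  cases a <;> cases b <;> cases c
  · exact h'.congr (fun i _ => by simp [px_map_act]) fun i _ => by simp [py_map_act]
  · exact h'.negY.congr (fun i _ => by simp [px_map_act]) fun i _ => by simp [py_map_act]
  · exact h'.negX.congr (fun i _ => by simp [px_map_act]) fun i _ => by simp [py_map_act]
  · exact h'.negX.negY.congr (fun i _ => by simp [px_map_act]) fun i _ => by simp [py_map_act]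
  · exact h'.swap.congr (fun i _ => by simp [px_map_act]) fun i _ => by simp [py_map_act]
  · exact h'.swap.negY.congr (fun i _ => by simp [px_map_act]) fun i _ => by simp [py_map_act]
  · exact h'.swap.negX.congr (fun i _ => by simp [px_map_act]) fun i _ => by simp [py_map_act]
  · exact h'.swap.negX.negY.congr (fun i _ => by simp [px_map_act])
      fun i _ => by simp [py_map_act]

theorem Ham_map_act (g : Bool × Bool × Bool) (s : List (ℤ × ℤ)) :
    Ham (s.map (act g)) = Ham s := by
  rw [Ham_eq, Ham_eq, List.length_map]
  refine hamFn_congr fun j _ i _ => ?_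
  unfold Touch
  simp only [px_map_act, py_map_act]
  obtain ⟨a, b, c⟩ := g
  have key : ∀ u v u' v' : ℤ, u ^ 2 = u' ^ 2 → v ^ 2 = v' ^ 2 →
      (u ^ 2 + v ^ 2 = 4 ↔ u' ^ 2 + v' ^ 2 = 4) := fun u v u' v' h1 h2 => by rw [h1, h2]
  cases a
  · refine key _ _ _ _ ?_ ?_
    · cases b <;> simp <;> ring
    · cases c <;> simp <;> ring
  · rw [add_comm]
    refine key _ _ _ _ ?_ ?_
    · cases c <;> simp <;> ring
    · cases b <;> simp <;> ring

/-! ## Reassembling a path from two-sided and straight pieces -/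

/-- A straight path of length `n`. -/
def straight (n : ℕ) : List (ℤ × ℤ) := List.replicate n (1, 0)

/-- The kinds of pieces: cut out of the corner path, cut out of the rising path, or straight. -/
inductive PieceKind | corner | rising | line

/-- A description of a piece: its kind, its position and length in the path it is cut out of,
and the symmetry to apply. -/
abbrev PieceCode := PieceKind × ℕ × ℕ × (Bool × Bool × Bool)

/-- The piece described by a code. -/
def decodePiece (Q R : List (ℤ × ℤ)) (c : PieceCode) : List (ℤ × ℤ) :=
  ((match c.1 with
    | .corner => (Q.drop c.2.1).take c.2.2.1
    | .rising => (R.drop c.2.1).take c.2.2.1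
    | .line => straight c.2.2.1).map (act c.2.2.2))

/-- The concatenation of the pieces described by a list of codes. -/
def decode (Q R : List (ℤ × ℤ)) (cs : List PieceCode) : List (ℤ × ℤ) :=
  (cs.map (decodePiece Q R)).flatten

/-- `w` can be reassembled from at most `k` pieces of a corner path, a rising path and straight
paths, with control of the Hamiltonian. -/
def Assembled (w : List (ℤ × ℤ)) (T t k : ℕ) : Prop :=
  ∃ (Q R : List (ℤ × ℤ)) (M : ℕ) (cs : List PieceCode), Pru Q ∧ TwoSided Q ∧ EndsAtCorner Q ∧
    Pru R ∧ NoDown R ∧ cs.length ≤ k ∧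
    (∀ c ∈ cs, c.2.1 ≤ t + k ∧ c.2.2.1 ≤ t + k) ∧
    (∀ X Y, decode (Q ++ X) (R ++ Y) cs = w.take t) ∧
    Ham (w.take t) ≤ Ham Q + Ham R + 2 * M + k * (10 * T) ∧
    Q.length + R.length + M ≤ t + k

theorem pru_nil : Pru [] := ⟨by simp, by simp, by simp, by simp, by simp⟩

theorem Assembled.zero (w : List (ℤ × ℤ)) (T k : ℕ) : Assembled w T 0 k := by
  refine ⟨[], [], 0, [], pru_nil, ?_, ?_, pru_nil, ?_, ?_, ?_, ?_, ?_, ?_⟩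
  · intro i hi; left; intro j hj; rw [show j = i by simp at hi; omega]
  · exact ⟨fun j hj => by rw [Nat.le_zero.1 hj]; simp, fun j hj => by rw [Nat.le_zero.1 hj]; simp⟩
  · simp [NoDown]
  · simp
  · simp
  · simp [decode]
  · simp [Ham]
  · simp

theorem Assembled.mono {w : List (ℤ × ℤ)} {T t k k' : ℕ} (h : Assembled w T t k) (hk : k ≤ k') :
    Assembled w T t k' := by
  obtain ⟨Q, R, M, cs, h1, h2, h3, h4, h5, h6, h7, h8, h9, h10⟩ := h
  refine ⟨Q, R, M, cs, h1, h2, h3, h4, h5, h6.trans hk, fun c hc => ?_, h8, h9.trans ?_, by omega⟩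
  · have := h7 c hc; omega
  · gcongr

theorem Pru.Ham_take_add {w : List (ℤ × ℤ)} (h : Pru w) {T t m : ℕ} (hm : t + m ≤ w.length)
    (hT : ∀ j, t ≤ j → j < t + m → runPos (px w) (py w) j < T) :
    Ham (w.take (t + m)) ≤ Ham (w.take t) + 10 * T + Ham ((w.drop t).take m) := by
  have h1 := PrudFn.hamFn_add_le_of_runPos_lt h hm hT
  rw [Ham_eq, Ham_eq, Ham_eq, List.length_take, List.length_take, List.length_take,
    List.length_drop, min_eq_left hm, min_eq_left (by omega), min_eq_left (by omega)]
  have e1 : hamFn (px (w.take (t + m))) (py (w.take (t + m))) (t + m) =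
      hamFn (px w) (py w) (t + m) :=
    hamFn_congr_coord (fun i hi => by simp [px, pt_take w hi]) fun i hi => by
      simp [py, pt_take w hi]
  have e2 : hamFn (px (w.take t)) (py (w.take t)) t = hamFn (px w) (py w) t :=
    hamFn_congr_coord (fun i hi => by simp [px, pt_take w hi]) fun i hi => by
      simp [py, pt_take w hi]
  have e3 : hamFn (fun i => px w (t + i)) (fun i => py w (t + i)) m =
      hamFn (px ((w.drop t).take m)) (py ((w.drop t).take m)) m := by
    rw [← hamFn_translate (px ((w.drop t).take m)) _ (px w t) (py w t)]
    exact hamFn_congr_coord (fun i hi => by simp [px, pt_take _ hi, pt_drop w t i]) fun i hi => by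
      simp [py, pt_take _ hi, pt_drop w t i]
  rw [e1, e2, ← e3]
  exact h1

theorem Pru.piece {w : List (ℤ × ℤ)} (h : Pru w) (t m : ℕ) : Pru ((w.drop t).take m) := by
  rw [← List.take_append_drop t w] at h
  have h' := h.of_append_right
  rw [← List.take_append_drop m (w.drop t)] at h'
  exact h'.of_append_left

theorem Pru.prefix {w : List (ℤ × ℤ)} (h : Pru w) (t : ℕ) : Pru (w.take t) := by
  rw [← List.take_append_drop t w] at h
  exact h.of_append_left

section assemble

variable {w : List (ℤ × ℤ)} {T t k m : ℕ}

theorem take_add_eq (w : List (ℤ × ℤ)) (t m : ℕ) :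
    w.take (t + m) = w.take t ++ (w.drop t).take m := List.take_add

theorem decode_append (Q R : List (ℤ × ℤ)) (cs : List PieceCode) (c : PieceCode) :
    decode Q R (cs ++ [c]) = decode Q R cs ++ decodePiece Q R c := by simp [decode]

theorem Assembled.straight (hw : Pru w) (h : Assembled w T t k) (hm : t + m ≤ w.length)
    {g : Bool × Bool × Bool} (hp : (w.drop t).take m = (_root_.straight m).map (act g)) :
    Assembled w T (t + m) (k + 1) := by
  obtain ⟨Q, R, M, cs, h1, h2, h3, h4, h5, h6, h7, h8, h9, h10⟩ := h
  refine ⟨Q, R, M + m, cs ++ [(.line, 0, m, g)], h1, h2, h3, h4, h5, by simpa using h6, ?_, ?_,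
    ?_, by omega⟩
  · intro c hc
    rcases List.mem_append.1 hc with hc | hc
    · have := h7 c hc; omega
    · rw [List.mem_singleton.1 hc]; dsimp only; omega
  · intro X Y
    rw [decode_append, h8, take_add_eq, hp]
    rfl
  · have h11 := hw.prefix (t + m)
    rw [take_add_eq] at h11 ⊢
    have h12 := h11.Ham_append_le
    rw [List.length_take, List.length_drop, min_eq_left (by omega)] at h12
    rw [Nat.add_mul]
    omega

theorem Assembled.rising (hw : Pru w) (h : Assembled w T t k) (hm : t + m ≤ w.length)
    (hT : ∀ j, t ≤ j → j < t + m → runPos (px w) (py w) j < T)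
    {g : Bool × Bool × Bool} (hp : NoDown (((w.drop t).take m).map (act g))) :
    Assembled w T (t + m) (k + 1) := by
  obtain ⟨Q, R, M, cs, h1, h2, h3, h4, h5, h6, h7, h8, h9, h10⟩ := h
  set P := (w.drop t).take m with hP
  have hlen : P.length = m := by
    rw [hP, List.length_take, List.length_drop, min_eq_left (by omega)]
  have hpru : Pru (P.map (act g)) := (hw.piece t m).map_act g
  refine ⟨Q, R ++ (0, 1) :: P.map (act g), M, cs ++ [(.rising, R.length + 1, m, actInv g)], h1, h2,
    h3, h4.append_noDown (h5.isRec h4 le_rfl) hpru hp, h5.append_up hp, by simpa using h6, ?_, ?_,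
    ?_, ?_⟩
  · intro c hc
    rcases List.mem_append.1 hc with hc | hc
    · have := h7 c hc; omega
    · rw [List.mem_singleton.1 hc]; dsimp only; omega
  · intro X Y
    rw [decode_append, List.append_assoc, h8, take_add_eq]
    congr 1
    unfold decodePiece
    dsimp only
    rw [List.drop_append, List.drop_eq_nil_of_le (by omega), List.nil_append,
      show R.length + 1 - R.length = 1 by omega, List.cons_append, List.drop_one, List.tail_cons,
      List.take_append_of_le_length (by simp [hlen]), List.take_of_length_le (by simp [hlen]),
      map_actInv]
  · have h11 := hw.Ham_take_add hm hT
    rw [← hP] at h11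
    have h12 := Ham_add_le R ((0, 1) :: P.map (act g))
    have h13 := Ham_le_cons (0, 1) (P.map (act g))
    rw [Ham_map_act] at h13
    rw [Nat.add_mul]
    omega
  · rw [length_append_up, List.length_map, hlen]; omega

theorem exists_head_ne_down {P : List (ℤ × ℤ)} {g : Bool × Bool × Bool}
    (hts : TwoSided (P.map (act g))) (hc : EndsAtCorner (P.map (act g))) :
    ∃ g', TwoSided (P.map (act g')) ∧ EndsAtCorner (P.map (act g')) ∧
      (P.map (act g')).head? ≠ some (0, -1) := by
  by_cases hd : (P.map (act g)).head? = some (0, -1)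
  · refine ⟨(!g.1, g.2.2, g.2.1), ?_⟩
    have e : ∀ d, act (!g.1, g.2.2, g.2.1) d = (act g d).swap := by
      intro d
      obtain ⟨a, b, c⟩ := g
      refine Prod.ext ?_ ?_ <;> cases a <;> cases b <;> cases c <;> simp [act]
    have e' : P.map (act (!g.1, g.2.2, g.2.1)) = (P.map (act g)).map Prod.swap := by
      rw [List.map_map]; exact List.map_congr_left fun d _ => e d
    rw [e']
    refine ⟨hts.swap, ⟨?_, ?_⟩, ?_⟩
    · rw [List.length_map, isRec_congr (x' := py (P.map (act g))) fun i _ => by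
        rw [px, py, pt_map_swap]; rfl]
      exact hc.2
    · rw [List.length_map, isRec_congr (x' := px (P.map (act g))) fun i _ => by
        rw [py, px, pt_map_swap]; rfl]
      exact hc.1
    · rw [List.head?_map, hd]; simp
  · exact ⟨g, hts, hc, hd⟩

theorem Assembled.corner (hw : Pru w) (h : Assembled w T t k) (hm : t + m ≤ w.length)
    (hT : ∀ j, t ≤ j → j < t + m → runPos (px w) (py w) j < T)
    {g : Bool × Bool × Bool} (hts : TwoSided (((w.drop t).take m).map (act g)))
    (hc : EndsAtCorner (((w.drop t).take m).map (act g))) :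
    Assembled w T (t + m) (k + 1) := by
  obtain ⟨g, hts, hc, hd⟩ := exists_head_ne_down hts hc
  obtain ⟨Q, R, M, cs, h1, h2, h3, h4, h5, h6, h7, h8, h9, h10⟩ := h
  set P := (w.drop t).take m with hP
  have hlen : P.length = m := by
    rw [hP, List.length_take, List.length_drop, min_eq_left (by omega)]
  have hpru : Pru (P.map (act g)) := (hw.piece t m).map_act g
  refine ⟨Q ++ (0, 1) :: P.map (act g), R, M, cs ++ [(.corner, Q.length + 1, m, actInv g)],
    h1.append_corner h3 hpru hts hd,
    h2.append_up h3.2 fun i hi => (hts i hi).imp (fun h => ⟨h3.1, h⟩) id,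
    h3.append_up hc, h4, h5, by simpa using h6, ?_, ?_, ?_, ?_⟩
  · intro c hc
    rcases List.mem_append.1 hc with hc | hc
    · have := h7 c hc; omega
    · rw [List.mem_singleton.1 hc]; dsimp only; omega
  · intro X Y
    rw [decode_append, List.append_assoc, h8, take_add_eq]
    congr 1
    unfold decodePiece
    dsimp only
    rw [List.drop_append, List.drop_eq_nil_of_le (by omega), List.nil_append,
      show Q.length + 1 - Q.length = 1 by omega, List.cons_append, List.drop_one, List.tail_cons,
      List.take_append_of_le_length (by simp [hlen]), List.take_of_length_le (by simp [hlen]),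
      map_actInv]
  · have h11 := hw.Ham_take_add hm hT
    rw [← hP] at h11
    have h12 := Ham_add_le Q ((0, 1) :: P.map (act g))
    have h13 := Ham_le_cons (0, 1) (P.map (act g))
    rw [Ham_map_act] at h13
    rw [Nat.add_mul]
    omega
  · rw [length_append_up, List.length_map, hlen]; omega

end assemble

/-! ## The shape of a piece between two cuts -/

/-- The extent of `z` up to time `n`. -/
def width (z : ℕ → ℤ) (n : ℕ) : ℤ := partialSups z n + partialSups (-z) n

theorem width_neg (z : ℕ → ℤ) (n : ℕ) : width (-z) n = width z n := by
  unfold width; rw [neg_neg, add_comm]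

theorem width_mono (z : ℕ → ℤ) : Monotone (width z) := fun _ _ h =>
  add_le_add ((partialSups z).monotone h) ((partialSups (-z)).monotone h)

theorem partialSups_lt_of_rise {z : ℕ → ℤ} {i : ℕ} (h : Rise z i) :
    partialSups z i < partialSups z (i + 1) := by
  have h1 : partialSups z i ≤ z (i + 1) - 1 := partialSups_le _ _ _ fun j hj => by
    have := h j hj; omega
  have h2 : z (i + 1) ≤ partialSups z (i + 1) := le_partialSups_of_le z le_rfl
  omega

theorem width_succ_of_rise {z : ℕ → ℤ} {i : ℕ} (h : Rise z i ∨ Rise (-z) i) :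
    width z i + 1 ≤ width z (i + 1) := by
  have h1 := (partialSups z).monotone (Nat.le_succ i)
  have h2 := (partialSups (-z)).monotone (Nat.le_succ i)
  simp only [Nat.succ_eq_add_one] at h1 h2
  unfold width
  rcases h with h | h
  · have := partialSups_lt_of_rise h; omega
  · have := partialSups_lt_of_rise h; omega

theorem partialSups_succ_of_not_rise {z : ℕ → ℤ} {i : ℕ} (h : ¬ Rise z i) :
    partialSups z (i + 1) = partialSups z i := by
  rw [partialSups_add_one, sup_eq_left]
  unfold Rise at h
  push Not at h
  obtain ⟨j, hj, h⟩ := h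
  exact h.trans (le_partialSups_of_le z hj)

theorem width_succ_of_not_rise {z : ℕ → ℤ} {i : ℕ} (h : ¬ Rise z i) (h' : ¬ Rise (-z) i) :
    width z (i + 1) = width z i := by
  unfold width
  rw [partialSups_succ_of_not_rise h, partialSups_succ_of_not_rise h']

theorem width_le_sub {z : ℕ → ℤ} {t i j : ℕ} (hi : IsRec z i) (hj : IsRec (-z) j) (hti : t ≤ i)
    (htj : t ≤ j) : width z t ≤ z i - z j := by
  have h1 : partialSups z t ≤ z i := partialSups_le _ _ _ fun k hk => hi k (by omega)
  have h2 : partialSups (-z) t ≤ (-z) j := partialSups_le _ _ _ fun k hk => hj k (by omega)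
  simp only [Pi.neg_apply] at h2
  unfold width
  omega

theorem Rise.isRec {z : ℕ → ℤ} {i : ℕ} (h : Rise z i) : IsRec z (i + 1) := fun j hj => by
  rcases Nat.lt_or_ge i j with h1 | h1
  · rw [show j = i + 1 by omega]
  · exact (h j h1).le

namespace PrudFn

variable {N : ℕ} {x y : ℕ → ℤ} {t u S : ℕ}

theorem y_lipschitz (h : PrudFn N x y) {i j : ℕ} (hij : i ≤ j) (hj : j ≤ N) :
    |y j - y i| ≤ (j : ℤ) - i := by
  induction j, hij using Nat.le_induction with
  | base => simp
  | succ j hij ih =>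
    have h1 := ih (by omega)
    have h2 := h.step j (by omega)
    rw [abs_le] at h1 ⊢
    push_cast
    omega

/-- A short piece cannot visit both the top and the bottom of a tall box. -/
theorem not_isRec_neg (h : PrudFn N x y) (hu : u ≤ N) (hlen : u ≤ t + S) (hy : (S : ℤ) < width y t)
    {i j : ℕ} (hti : t ≤ i) (hiu : i ≤ u) (htj : t ≤ j) (hju : j ≤ u) (hi : IsRec y i) :
    ¬ IsRec (-y) j := by
  intro hj
  have h1 := width_le_sub hi hj hti htj
  rcases le_total i j with hij | hij
  · have h2 := h.y_lipschitz hij (by omega)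
    rw [abs_le] at h2
    omega
  · have h2 := h.y_lipschitz hij (by omega)
    rw [abs_le] at h2
    omega

theorem no_reversal (h : PrudFn N x y) {i : ℕ} (hi : i + 1 < N) (e : x (i + 1) = x i)
    (e' : x (i + 1 + 1) = x (i + 1)) : y (i + 1 + 1) - y (i + 1) = y (i + 1) - y i := by
  by_contra hc
  have h1 := h.step i (by omega)
  have h2 := h.step (i + 1) hi
  have := h.eq_of_eq (i := i) (j := i + 1 + 1) (by omega) (by omega) (by omega) (by omega)
  omega

theorem noDown_of_thin_top (h : PrudFn N x y) (hu : u ≤ N) (hlen : u ≤ t + S)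
    (hx : ∀ i, t ≤ i → i < u → ¬ Rise x i ∧ ¬ Rise (-x) i) (hy : (S : ℤ) < width y t) {i : ℕ}
    (hti : t ≤ i) (hiu : i < u) (e : y (i + 1) = y i) (hr : IsRec y i) {j : ℕ}
    (htj : t ≤ j) (hju : j < u) : y j ≤ y (j + 1) := by
  by_contra hc
  have hbot : ∀ k, t ≤ k → k ≤ u → ¬ IsRec (-y) k := fun k h1 h2 =>
    h.not_isRec_neg hu hlen hy hti hiu.le h1 h2 hr
  have fwd : ∀ k, t ≤ k → k + 1 < u → y (k + 1) < y k → y (k + 1 + 1) < y (k + 1) := by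
    intro k h1 h2 h3
    have s1 := h.step k (by omega)
    rcases h.horizontal_or_vertical (j := k + 1) (by omega) with h4 | h4
    · rcases h.horizontal_step (by omega) h4 with h5 | h5 | h5 | h5
      · exact absurd h5 (hx _ (by omega) h2).1
      · exact absurd h5 (hx _ (by omega) h2).2
      · have := h5 k (by omega); omega
      · exact absurd h5 (hbot _ (by omega) (by omega))
    · have := h.no_reversal (i := k) (by omega) (by omega) h4
      omega
  have bwd : ∀ k, t ≤ k → k + 1 < u → y (k + 1 + 1) < y (k + 1) → y (k + 1) < y k := by
    intro k h1 h2 h3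
    have s1 := h.step (k + 1) (by omega)
    rcases h.horizontal_or_vertical (j := k) (by omega) with h4 | h4
    · have n0 : ¬ LeavesBox x y k := by
        rintro (h5 | h5 | h5 | h5)
        · exact (hx _ h1 (by omega)).1 h5
        · exact (hx _ h1 (by omega)).2 h5
        · have := h5 k le_rfl; omega
        · have := h5 k le_rfl; simp only [Pi.neg_apply] at this; omega
      have n1 : ¬ LeavesBox x y (k + 1) := by
        rintro (h5 | h5 | h5 | h5)
        · exact (hx _ (by omega) (by omega)).1 h5
        · exact (hx _ (by omega) (by omega)).2 h5
        · have := h5 (k + 1) le_rfl; omega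
        · exact hbot _ (by omega) (by omega) h5.isRec
      have h6 : y (k + 1 + 1) - y (k + 1) = y (k + 1) - y k :=
        (h.straight_of_not_leavesBox (by omega) n0 n1).2
      omega
    · have := h.no_reversal (i := k) (by omega) h4 (by omega)
      omega
  have up : ∀ n, j + n < u → y (j + n + 1) < y (j + n) := by
    intro n hn
    induction n with
    | zero => simpa using hc
    | succ n ih => exact fwd (j + n) (by omega) (by omega) (ih (by omega))
  have dn : ∀ n, t + n ≤ j → y (j - n + 1) < y (j - n) := by
    intro n hn
    induction n with
    | zero => simpa using hc
    | succ n ih =>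
      have h1 := ih (by omega)
      rw [show j - n = j - (n + 1) + 1 by omega] at h1
      exact bwd (j - (n + 1)) (by omega) (by omega) h1
  rcases le_total j i with hji | hji
  · have := up (i - j) (by omega)
    rw [show j + (i - j) = i by omega] at this
    omega
  · have := dn (j - i) (by omega)
    rw [show j - (j - i) = i by omega] at this
    omega

/-- The shape of a short piece that extends the box only vertically, in a tall box. -/
theorem thin_piece (h : PrudFn N x y) (hu : u ≤ N) (hlen : u ≤ t + S)
    (hx : ∀ i, t ≤ i → i < u → ¬ Rise x i ∧ ¬ Rise (-x) i) (hy : (S : ℤ) < width y t) :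
    (∀ i, t ≤ i → i < u → y i ≤ y (i + 1)) ∨ (∀ i, t ≤ i → i < u → y (i + 1) ≤ y i) ∨
    (∀ i, t ≤ i → i + 1 < u → x (i + 1 + 1) - x (i + 1) = x (i + 1) - x i ∧
      y (i + 1 + 1) - y (i + 1) = y (i + 1) - y i) := by
  by_cases hex : ∃ i, t ≤ i ∧ i < u ∧ y (i + 1) = y i
  · obtain ⟨i, hti, hiu, e⟩ := hex
    rcases h.horizontal_step (by omega) e with h1 | h1 | h1 | h1
    · exact absurd h1 (hx i hti hiu).1
    · exact absurd h1 (hx i hti hiu).2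
    · exact .inl fun j htj hju => h.noDown_of_thin_top hu hlen hx hy hti hiu e h1 htj hju
    · refine .inr (.inl fun j htj hju => ?_)
      have := h.negY.noDown_of_thin_top hu hlen hx (by rwa [width_neg]) hti hiu (by simpa using e)
        h1 htj hju
      simp only [Pi.neg_apply] at this
      omega
  · push Not at hex
    refine .inr (.inr fun i hti hiu => ?_)
    have v1 : x (i + 1) = x i :=
      (h.horizontal_or_vertical (j := i) (by omega)).resolve_left (hex i hti (by omega))
    have v2 : x (i + 1 + 1) = x (i + 1) :=
      (h.horizontal_or_vertical (j := i + 1) (by omega)).resolve_left (hex _ (by omega) hiu)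
    exact ⟨by omega, h.no_reversal (by omega) v1 v2⟩

/-- A two-sided piece splits into a part ending at a corner and a part monotone in one
coordinate. -/
theorem exists_last_corner (h : PrudFn N x y) (htu : t ≤ u) (hu : u ≤ N)
    (hts : ∀ i, t ≤ i → i ≤ u → IsRec x i ∨ IsRec y i) :
    ∃ τ, t ≤ τ ∧ τ ≤ u ∧ (τ = t ∨ IsRec x τ ∧ IsRec y τ) ∧
      ((IsRec x u ∧ ∀ i, τ ≤ i → i < u → x i ≤ x (i + 1)) ∨
        (IsRec y u ∧ ∀ i, τ ≤ i → i < u → y i ≤ y (i + 1))) := by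
  induction u, htu using Nat.le_induction with
  | base =>
    refine ⟨t, le_rfl, le_rfl, .inl rfl, (hts t le_rfl le_rfl).imp ?_ ?_⟩ <;>
      exact fun h => ⟨h, fun i h1 h2 => by omega⟩
  | succ u htu ih =>
    obtain ⟨τ, h1, h2, h3, h4⟩ := ih (by omega) fun i h1 h2 => hts i h1 (by omega)
    have key : ∀ x y : ℕ → ℤ, PrudFn N x y → IsRec x u →
        (∀ i, τ ≤ i → i < u → x i ≤ x (i + 1)) → (IsRec x (u + 1) ∨ IsRec y (u + 1)) →
        (IsRec x (u + 1) ∧ ∀ i, τ ≤ i → i < u + 1 → x i ≤ x (i + 1)) ∨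
        (IsRec y (u + 1) ∧ IsRec y u ∧ ∀ i, u ≤ i → i < u + 1 → y i ≤ y (i + 1)) := by
      intro x y h hxu hmon hor
      by_cases hx1 : IsRec x (u + 1)
      · refine .inl ⟨hx1, fun i hi hi' => ?_⟩
        rcases Nat.lt_or_ge i u with h5 | h5
        · exact hmon i hi h5
        · rw [show i = u by omega]; exact hx1 u (by omega)
      · have hy1 := hor.resolve_left hx1
        have hlt : x (u + 1) < x u := by
          by_contra hc
          refine hx1 fun j hj => ?_
          rcases Nat.lt_or_ge u j with h5 | h5
          · rw [show j = u + 1 by omega]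
          · have := hxu j h5; omega
        have hs := h.step u (by omega)
        refine .inr ⟨hy1, fun j hj => ?_, fun i hi hi' => ?_⟩
        · have := hy1 j (by omega); omega
        · rw [show i = u by omega]; omega
    rcases h4 with ⟨hr, hm⟩ | ⟨hr, hm⟩
    · rcases key x y h hr hm (hts _ (by omega) le_rfl) with h5 | ⟨h5, h6, h7⟩
      · exact ⟨τ, h1, by omega, h3, .inl h5⟩
      · exact ⟨u, htu, by omega, .inr ⟨hr, h6⟩, .inr ⟨h5, h7⟩⟩
    · rcases key y x h.swap hr hm (hts _ (by omega) le_rfl).symm with h5 | ⟨h5, h6, h7⟩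
      · exact ⟨τ, h1, by omega, h3, .inr h5⟩
      · exact ⟨u, htu, by omega, .inr ⟨h6, hr⟩, .inl ⟨h5, h7⟩⟩

/-- `z` or its opposite. -/
def _root_.signed (b : Bool) (z : ℕ → ℤ) : ℕ → ℤ := if b then -z else z

theorem signed_signed (h : PrudFn N x y) (a b : Bool) : PrudFn N (signed a x) (signed b y) := by
  cases a <;> cases b
  · exact h
  · exact h.negY
  · exact h.negX
  · exact h.negX.negY

/-- A short piece in a large box is two-sided, up to reflections. -/
theorem exists_signed_twoSided (h : PrudFn N x y) (hu : u ≤ N) (hlen : u ≤ t + S)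
    (hx : (S : ℤ) < width x t) (hy : (S : ℤ) < width y t) :
    ∃ a b, ∀ i, t ≤ i → i ≤ u → IsRec (signed a x) i ∨ IsRec (signed b y) i := by
  have key : ∀ x y : ℕ → ℤ, PrudFn N x y → (S : ℤ) < width y t →
      ∃ b, ∀ i, t ≤ i → i ≤ u → ¬ IsRec (-(signed b y)) i := by
    intro x y h hy
    by_cases hex : ∃ i, t ≤ i ∧ i ≤ u ∧ IsRec (-y) i
    · obtain ⟨i, hi, hiu, hr⟩ := hex
      exact ⟨true, fun j h1 h2 => h.negY.not_isRec_neg hu hlen (by rwa [width_neg]) hi hiu h1 h2 hr⟩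
    · push Not at hex
      exact ⟨false, hex⟩
  obtain ⟨b, hb⟩ := key x y h hy
  obtain ⟨a, ha⟩ := key y x h.swap hx
  refine ⟨a, b, fun i h1 h2 => ?_⟩
  have h3 := (h.signed_signed a b).boundary (i := i) (by omega)
  have h4 := ha i h1 h2
  have h5 := hb i h1 h2
  tauto

end PrudFn

/-! ## Cutting a path into pieces -/

section pieces

variable {w : List (ℤ × ℤ)} {t m : ℕ}

theorem length_piece (hm : t + m ≤ w.length) : ((w.drop t).take m).length = m := by
  rw [List.length_take, List.length_drop, min_eq_left (by omega)]

theorem px_piece (w : List (ℤ × ℤ)) (t : ℕ) {m i : ℕ} (hi : i ≤ m) :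
    px ((w.drop t).take m) i = px w (t + i) - px w t := by
  simp [px, pt_take _ hi, pt_drop w t i]

theorem py_piece (w : List (ℤ × ℤ)) (t : ℕ) {m i : ℕ} (hi : i ≤ m) :
    py ((w.drop t).take m) i = py w (t + i) - py w t := by
  simp [py, pt_take _ hi, pt_drop w t i]

theorem exists_act_right {d : ℤ × ℤ} (h : d = (1, 0) ∨ d = (-1, 0) ∨ d = (0, 1) ∨ d = (0, -1)) :
    ∃ g, act g (1, 0) = d := by
  rcases h with rfl | rfl | rfl | rfl
  · exact ⟨(false, false, false), by simp [act]⟩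
  · exact ⟨(false, true, false), by simp [act]⟩
  · exact ⟨(true, false, false), by simp [act]⟩
  · exact ⟨(true, false, true), by simp [act]⟩

theorem Pru.exists_straight (hw : Pru w) (hm : t + m ≤ w.length)
    (hs : ∀ i, t ≤ i → i + 1 < t + m →
      px w (i + 1 + 1) - px w (i + 1) = px w (i + 1) - px w i ∧
      py w (i + 1 + 1) - py w (i + 1) = py w (i + 1) - py w i) :
    ∃ g, (w.drop t).take m = (straight m).map (act g) := by
  rcases Nat.eq_zero_or_pos m with rfl | hpos
  · exact ⟨(false, false, false), by simp [straight]⟩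
  obtain ⟨g, hg⟩ := exists_act_right (hw.mem_cases (List.getElem_mem (by omega : t < w.length)))
  refine ⟨g, List.ext_getElem (by rw [length_piece hm]; simp [straight]) fun i h1 h2 => ?_⟩
  rw [length_piece hm] at h1
  simp only [straight, List.map_replicate, List.getElem_replicate, List.getElem_take,
    List.getElem_drop, hg]
  clear h2
  induction i with
  | zero => rfl
  | succ i ih =>
    rw [← ih (by omega) (by omega), Pru.step_eq, Pru.step_eq]
    have := hs (t + i) (by omega) (by omega)
    exact Prod.ext this.1 this.2

theorem noDown_piece (hm : t + m ≤ w.length) (c b : Bool)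
    (hmon : ∀ i, t ≤ i → i < t + m →
      signed b (if c then px w else py w) i ≤ signed b (if c then px w else py w) (i + 1)) :
    NoDown (((w.drop t).take m).map (act (c, false, b))) := by
  intro d hd
  obtain ⟨e, he, rfl⟩ := List.mem_map.1 hd
  obtain ⟨i, hi, rfl⟩ := List.getElem_of_mem he
  rw [length_piece hm] at hi
  have h1 := hmon (t + i) (by omega) (by omega)
  rw [List.getElem_take, List.getElem_drop, Pru.step_eq]
  intro h2
  have h3 := congrArg Prod.snd h2
  cases c <;> cases b <;> simp [act, signed] at h1 h3 <;> omega

theorem isRec_px_piece (a b : Bool) {i : ℕ} (hi : i ≤ m)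
    (h : IsRec (signed a (px w)) (t + i)) :
    IsRec (px (((w.drop t).take m).map (act (false, a, b)))) i := by
  intro j hj
  have := h (t + j) (by omega)
  rw [px_map_act, px_map_act]
  simp only [Bool.false_eq_true, if_false]
  rw [px_piece w t (by omega), px_piece w t hi]
  cases a <;> simp [signed] at this ⊢ <;> omega

theorem isRec_py_piece (a b : Bool) {i : ℕ} (hi : i ≤ m)
    (h : IsRec (signed b (py w)) (t + i)) :
    IsRec (py (((w.drop t).take m).map (act (false, a, b)))) i := by
  intro j hj
  have := h (t + j) (by omega)
  rw [py_map_act, py_map_act]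
  simp only [Bool.false_eq_true, if_false]
  rw [py_piece w t (by omega), py_piece w t hi]
  cases b <;> simp [signed] at this ⊢ <;> omega

end pieces

/-- Step `i` extends the range of `z`, which is still at most `S`. -/
def ThinRise (S : ℕ) (z : ℕ → ℤ) (i : ℕ) : Prop := (Rise z i ∨ Rise (-z) i) ∧ width z i ≤ S

/-- The times at which a path is cut. -/
def IsCut (S T : ℕ) (x y : ℕ → ℤ) (c : ℕ) : Prop :=
  S ∣ c ∨ (ThinRise S x c ∨ ThinRise S x (c - 1)) ∨ (ThinRise S y c ∨ ThinRise S y (c - 1)) ∨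
    ¬ (T ≤ runPos x y c ↔ T ≤ runPos x y (c - 1))

section

variable {S T t u k : ℕ}

theorem not_rise_of_thin {z : ℕ → ℤ} (h : ∀ i, t ≤ i → i < u → ¬ ThinRise S z i)
    (hz : width z t ≤ S) {i : ℕ} (hti : t ≤ i) (hiu : i < u) : ¬ Rise z i ∧ ¬ Rise (-z) i := by
  have key : ∀ i, t ≤ i → i < u → width z i ≤ S := by
    intro i hti
    induction i, hti using Nat.le_induction with
    | base => exact fun _ => hz
    | succ i hti ih =>
      intro hiu
      have h1 := ih (by omega)
      have h2 := h i hti (by omega)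
      unfold ThinRise at h2
      rw [width_succ_of_not_rise (by tauto) (by tauto)]
      exact h1
  have h1 := key i hti hiu
  have h2 := h i hti hiu
  unfold ThinRise at h2
  tauto

theorem le_add_of_no_dvd (hS : 0 < S) (h : ∀ c, t < c → c < u → ¬ S ∣ c) : u ≤ t + S := by
  by_contra hc
  have h1 := Nat.div_add_mod t S
  have h2 := Nat.mod_lt t hS
  refine h (S * (t / S + 1)) ?_ ?_ (Nat.dvd_mul_right _ _) <;> rw [Nat.mul_add] <;> omega

theorem Assembled.piece {w : List (ℤ × ℤ)} (hw : Pru w) (hS : 0 < S) (hT : 0 < T)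
    (h : Assembled w T t k) (htu : t < u) (hu : u ≤ w.length)
    (hc : ∀ c, t < c → c < u → ¬ IsCut S T (px w) (py w) c) : Assembled w T u (k + 2) := by
  have hw' : PrudFn w.length (px w) (py w) := hw
  have hstraight : (∀ i, t ≤ i → i + 1 < u →
      px w (i + 1 + 1) - px w (i + 1) = px w (i + 1) - px w i ∧
      py w (i + 1 + 1) - py w (i + 1) = py w (i + 1) - py w i) → Assembled w T u (k + 2) := by
    intro hs
    obtain ⟨g, hg⟩ := hw.exists_straight (t := t) (m := u - t) (by omega)
      (fun i h1 h2 => hs i h1 (by omega))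
    have := (h.straight hw (by omega) hg).mono (show k + 1 ≤ k + 2 by omega)
    rwa [show t + (u - t) = u by omega] at this
  by_cases hu1 : u = t + 1
  · exact hstraight fun i h1 h2 => by omega
  have hthin : ∀ i, t ≤ i → i < u → ¬ ThinRise S (px w) i ∧ ¬ ThinRise S (py w) i := by
    intro i h1 h2
    rcases h1.eq_or_lt with rfl | h1
    · have := hc (t + 1) (by omega) (by omega)
      unfold IsCut at this
      rw [Nat.add_sub_cancel] at this
      tauto
    · have := hc i h1 h2
      unfold IsCut at this
      tauto
  have hlen : u ≤ t + S := le_add_of_no_dvd hS fun c h1 h2 h3 => hc c h1 h2 (.inl h3)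
  have hnl : ∀ {p : Prop}, (∀ i, t ≤ i → i < u → ¬ LeavesBox (px w) (py w) i) →
      (Assembled w T u (k + 2) → p) → p := fun h1 h2 => h2 <| hstraight fun i h3 h4 =>
    hw'.straight_of_not_leavesBox (by omega) (h1 i h3 (by omega)) (h1 _ (by omega) h4)
  have hrun : ∀ i, t ≤ i → i < u →
      (T ≤ runPos (px w) (py w) i ↔ T ≤ runPos (px w) (py w) t) := by
    intro i hti
    induction i, hti using Nat.le_induction with
    | base => exact fun _ => Iff.rfl
    | succ i hti ih =>
      intro hiu
      rw [← ih (by omega)]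
      have := hc (i + 1) (by omega) hiu
      unfold IsCut at this
      rw [Nat.add_sub_cancel] at this
      tauto
  by_cases hTt : T ≤ runPos (px w) (py w) t
  · refine hnl (fun i h1 h2 => ?_) id
    have h3 := (hrun i h1 h2).2 hTt
    simpa using not_leavesBox_of_lt_runPos (k := 0) (hT.trans_le h3)
  have hlow : ∀ i, t ≤ i → i < u → runPos (px w) (py w) i < T := fun i h1 h2 => by
    have := hrun i h1 h2
    omega
  have hrising : ∀ {τ k'}, t ≤ τ → τ ≤ u → Assembled w T τ k' → k' ≤ k + 1 → ∀ c b : Bool,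
      (∀ i, τ ≤ i → i < u →
        signed b (if c then px w else py w) i ≤ signed b (if c then px w else py w) (i + 1)) →
      Assembled w T u (k + 2) := by
    intro τ k' h1 h2 h3 h4 c b hmon
    have h5 := noDown_piece (w := w) (t := τ) (m := u - τ) (by omega) c b
      fun i h6 h7 => hmon i h6 (by omega)
    have := (h3.rising hw (by omega) (fun j h6 h7 => hlow j (by omega) (by omega)) h5).mono
      (show k' + 1 ≤ k + 2 by omega)
    rwa [show τ + (u - τ) = u by omega] at this
  by_cases hx : width (px w) t ≤ S
  · have hx' := fun i h1 h2 => not_rise_of_thin (fun i h1 h2 => (hthin i h1 h2).1) hx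
      (i := i) h1 h2
    by_cases hy : width (py w) t ≤ S
    · have hy' := fun i h1 h2 => not_rise_of_thin (fun i h1 h2 => (hthin i h1 h2).2) hy
        (i := i) h1 h2
      refine hnl (fun i h1 h2 => ?_) id
      have h3 := hx' i h1 h2
      have h4 := hy' i h1 h2
      unfold LeavesBox
      tauto
    · rcases hw'.thin_piece hu hlen hx' (not_le.1 hy) with h1 | h1 | h1
      · exact hrising le_rfl htu.le h (by omega) false false h1
      · exact hrising le_rfl htu.le h (by omega) false true fun i h2 h3 => by
          simpa [signed] using h1 i h2 h3
      · exact hstraight h1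
  · by_cases hy : width (py w) t ≤ S
    · have hy' := fun i h1 h2 => not_rise_of_thin (fun i h1 h2 => (hthin i h1 h2).2) hy
        (i := i) h1 h2
      rcases hw'.swap.thin_piece hu hlen hy' (not_le.1 hx) with h1 | h1 | h1
      · exact hrising le_rfl htu.le h (by omega) true false h1
      · exact hrising le_rfl htu.le h (by omega) true true fun i h2 h3 => by
          simpa [signed] using h1 i h2 h3
      · exact hstraight fun i h2 h3 => (h1 i h2 h3).symm
    · obtain ⟨a, b, hab⟩ := hw'.exists_signed_twoSided hu hlen (not_le.1 hx) (not_le.1 hy)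
      obtain ⟨τ, h1, h2, h3, h4⟩ := (hw'.signed_signed a b).exists_last_corner htu.le hu hab
      have hτ : Assembled w T τ (k + 1) := by
        rcases h3 with rfl | ⟨h3, h3'⟩
        · exact h.mono (by omega)
        · have e : t + (τ - t) = τ := by omega
          have hm : t + (τ - t) ≤ w.length := by omega
          have := h.corner hw (t := t) (m := τ - t) hm
            (fun j h6 h7 => hlow j h6 (by omega)) (g := (false, a, b)) ?_ ?_
          · rwa [e] at this
          · intro i hi
            rw [List.length_map, length_piece hm] at hi
            exact (hab (t + i) (by omega) (by omega)).imp (isRec_px_piece a b hi)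
              (isRec_py_piece a b hi)
          · unfold EndsAtCorner
            rw [List.length_map, length_piece hm]
            exact ⟨isRec_px_piece a b le_rfl (by rwa [e]),
              isRec_py_piece a b le_rfl (by rwa [e])⟩
      rcases h4 with ⟨_, h4⟩ | ⟨_, h4⟩
      · exact hrising h1 h2 hτ le_rfl true a h4
      · exact hrising h1 h2 hτ le_rfl false b h4

open scoped Classical in
theorem assembled_of_cuts {w : List (ℤ × ℤ)} (hw : Pru w) (hS : 0 < S) (hT : 0 < T) (u : ℕ)
    (hu : u ≤ w.length) :
    Assembled w T u (2 * ((Finset.range u).filter (IsCut S T (px w) (py w))).card) := by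
  induction u using Nat.strong_induction_on with
  | _ u ih =>
    rcases Nat.eq_zero_or_pos u with rfl | hpos
    · exact Assembled.zero _ _ _
    have hne : ((Finset.range u).filter (IsCut S T (px w) (py w))).Nonempty :=
      ⟨0, by simp [hpos, IsCut]⟩
    set t := ((Finset.range u).filter (IsCut S T (px w) (py w))).max' hne with ht
    have hmem := Finset.max'_mem _ hne
    rw [← ht] at hmem
    have htu : t < u := by simpa using (Finset.mem_filter.1 hmem).1
    have h1 := (ih t htu (by omega)).piece hw hS hT htu hu fun c h2 h3 h4 => by
      have := Finset.le_max' ((Finset.range u).filter (IsCut S T (px w) (py w))) c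
        (by simp [h3, h4])
      omega
    refine h1.mono ?_
    have h2 : (Finset.range t).filter (IsCut S T (px w) (py w)) ⊂
        (Finset.range u).filter (IsCut S T (px w) (py w)) := by
      refine Finset.ssubset_iff_subset_ne.2 ⟨Finset.filter_subset_filter _ (by
        simpa using htu.le), fun e => ?_⟩
      rw [← e] at hmem
      simp at hmem
    have := Finset.card_lt_card h2
    omega

end

/-! ## The number of cuts -/

theorem width_nonneg (z : ℕ → ℤ) (n : ℕ) : 0 ≤ width z n := by
  have h1 : z n ≤ partialSups z n := le_partialSups_of_le z le_rfl
  have h2 : (-z) n ≤ partialSups (-z) n := le_partialSups_of_le (-z) le_rfl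
  simp only [Pi.neg_apply] at h2
  unfold width
  omega

section count

open scoped Classical

theorem card_thinRise_le (S : ℕ) (z : ℕ → ℤ) (L : ℕ) :
    ((Finset.range L).filter (ThinRise S z)).card ≤ S + 1 := by
  have hlt : ∀ i j, ThinRise S z i → i < j → width z i < width z j := fun i j hi hij => by
    have h1 := width_succ_of_rise hi.1
    have h2 := width_mono z (show i + 1 ≤ j by omega)
    omega
  calc _ ≤ (Finset.Icc (0 : ℤ) S).card := by
        refine Finset.card_le_card_of_injOn (width z) (fun i hi => ?_) fun i hi j hj e => ?_
        · have := (Finset.mem_filter.1 hi).2.2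
          simp [width_nonneg, this]
        · rcases lt_trichotomy i j with h | h | h
          · exact absurd e (hlt i j (Finset.mem_filter.1 hi).2 h).ne
          · exact h
          · exact absurd e (hlt j i (Finset.mem_filter.1 hj).2 h).ne'
    _ = S + 1 := by simp

theorem card_pred_le (p : ℕ → Prop) (L : ℕ) :
    ((Finset.range L).filter fun c => p (c - 1)).card ≤ ((Finset.range L).filter p).card + 1 := by
  calc _ ≤ (insert 0 (((Finset.range L).filter p).image Nat.succ)).card := by
        refine Finset.card_le_card fun c hc => ?_
        rw [Finset.mem_filter, Finset.mem_range] at hc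
        rcases Nat.eq_zero_or_pos c with rfl | h
        · exact Finset.mem_insert_self _ _
        · refine Finset.mem_insert_of_mem (Finset.mem_image.2 ⟨c - 1, ?_, by omega⟩)
          simp only [Finset.mem_filter, Finset.mem_range]
          exact ⟨by omega, hc.2⟩
    _ ≤ _ := (Finset.card_insert_le _ _).trans (Nat.add_le_add_right Finset.card_image_le 1)

theorem card_dvd_le {S : ℕ} (L : ℕ) : ((Finset.range L).filter (S ∣ ·)).card ≤ L / S + 1 := by
  calc _ ≤ (Finset.range (L / S + 1)).card := by
        refine Finset.card_le_card_of_injOn (· / S) (fun i hi => ?_) fun i hi j hj e => ?_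
        · have := (Finset.mem_range.1 (Finset.mem_filter.1 hi).1)
          have := Nat.div_le_div_right (c := S) this.le
          simp only [Finset.coe_range, Set.mem_Iio]
          omega
        · have h1 := Nat.div_mul_cancel (Finset.mem_filter.1 hi).2
          have h2 := Nat.div_mul_cancel (Finset.mem_filter.1 hj).2
          rw [← h1, ← h2]
          exact congrArg (· * S) e
    _ = _ := by simp

theorem card_flip_le {r : ℕ → ℕ} (h0 : r 0 = 0) (hr : ∀ n, r (n + 1) ≤ r n + 1) {T : ℕ}
    (hT : 0 < T) (L : ℕ) :
    ((Finset.range L).filter fun c => ¬ (T ≤ r c ↔ T ≤ r (c - 1))).card ≤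
      2 * ((Finset.range L).filter fun c => r c = T).card := by
  have key : ∀ n, ((Finset.range (n + 1)).filter fun c => ¬ (T ≤ r c ↔ T ≤ r (c - 1))).card +
      (if T ≤ r n then 1 else 0) ≤ 2 * ((Finset.range (n + 1)).filter fun c => r c = T).card := by
    intro n
    induction n with
    | zero => simp [Finset.filter_singleton, h0, hT.ne']
    | succ n ih =>
      rw [Finset.range_add_one, Finset.filter_insert, Finset.filter_insert]
      have h1 := hr n
      have e1 : n + 1 ∉ (Finset.range (n + 1)).filter fun c => ¬ (T ≤ r c ↔ T ≤ r (c - 1)) := by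
        simp
      have e2 : n + 1 ∉ (Finset.range (n + 1)).filter fun c => r c = T := by simp
      rw [apply_ite Finset.card, apply_ite Finset.card, Finset.card_insert_of_notMem e1,
        Finset.card_insert_of_notMem e2, Nat.add_sub_cancel]
      split_ifs at ih ⊢ <;> omega
  cases L with
  | zero => simp
  | succ n => exact (Nat.le_add_right _ _).trans (key n)

theorem card_isCut_le (S : ℕ) {T : ℕ} (hT : 0 < T) (x y : ℕ → ℤ) (L : ℕ) :
    ((Finset.range L).filter (IsCut S T x y)).card ≤
      L / S + 4 * S + 7 + 2 * ((Finset.range L).filter fun c => runPos x y c = T).card := by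
  have hsub : (Finset.range L).filter (IsCut S T x y) ⊆
      (Finset.range L).filter (S ∣ ·) ∪
      (((Finset.range L).filter (ThinRise S x) ∪
        (Finset.range L).filter fun c => ThinRise S x (c - 1)) ∪
      (((Finset.range L).filter (ThinRise S y) ∪
        (Finset.range L).filter fun c => ThinRise S y (c - 1)) ∪
      (Finset.range L).filter fun c => ¬ (T ≤ runPos x y c ↔ T ≤ runPos x y (c - 1)))) := by
    simp only [← Finset.filter_or]
    exact fun c hc => by simpa only [Finset.mem_filter, IsCut] using hc
  have h1 := Finset.card_le_card hsub
  have u1 := Finset.card_union_le ((Finset.range L).filter (S ∣ ·))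
    (((Finset.range L).filter (ThinRise S x) ∪
        (Finset.range L).filter fun c => ThinRise S x (c - 1)) ∪
      (((Finset.range L).filter (ThinRise S y) ∪
        (Finset.range L).filter fun c => ThinRise S y (c - 1)) ∪
      (Finset.range L).filter fun c => ¬ (T ≤ runPos x y c ↔ T ≤ runPos x y (c - 1))))
  have u2 := Finset.card_union_le ((Finset.range L).filter (ThinRise S x) ∪
        (Finset.range L).filter fun c => ThinRise S x (c - 1))
      (((Finset.range L).filter (ThinRise S y) ∪
        (Finset.range L).filter fun c => ThinRise S y (c - 1)) ∪
      (Finset.range L).filter fun c => ¬ (T ≤ runPos x y c ↔ T ≤ runPos x y (c - 1)))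
  have u3 := Finset.card_union_le ((Finset.range L).filter (ThinRise S x))
    ((Finset.range L).filter fun c => ThinRise S x (c - 1))
  have u4 := Finset.card_union_le ((Finset.range L).filter (ThinRise S y) ∪
        (Finset.range L).filter fun c => ThinRise S y (c - 1))
      ((Finset.range L).filter fun c => ¬ (T ≤ runPos x y c ↔ T ≤ runPos x y (c - 1)))
  have u5 := Finset.card_union_le ((Finset.range L).filter (ThinRise S y))
    ((Finset.range L).filter fun c => ThinRise S y (c - 1))
  have c1 := card_dvd_le (S := S) L
  have c2 := card_thinRise_le S x L
  have c3 := card_thinRise_le S y L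
  have c4 := card_pred_le (ThinRise S x) L
  have c5 := card_pred_le (ThinRise S y) L
  have c6 := card_flip_le (r := runPos x y) (by have := runPos_le x y 0; omega)
    (runPos_succ_le x y) hT L
  omega

theorem Pru.assembled {w : List (ℤ × ℤ)} (hw : Pru w) {S T : ℕ} (hS : 0 < S) (hT : 0 < T) :
    Assembled w T w.length (2 * (w.length / S) + 8 * S + 14 +
      4 * ((Finset.range w.length).filter fun c => runPos (px w) (py w) c = T).card) := by
  refine (assembled_of_cuts hw hS hT w.length le_rfl).mono ?_
  have := card_isCut_le S hT (px w) (py w) w.length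
  omega

end count

/-! ## Choosing the scale -/

theorem log_sub_log_le_sum_inv {A B : ℕ} (hA : 0 < A) (hAB : A ≤ B) :
    Real.log B - Real.log A ≤ ∑ T ∈ Finset.Ico A B, (T : ℝ)⁻¹ := by
  induction B, hAB using Nat.le_induction with
  | base => simp
  | succ B hAB ih =>
    rw [Finset.sum_Ico_succ_top hAB]
    have hB : (0 : ℝ) < B := by exact_mod_cast hA.trans_le hAB
    have h1 : Real.log (B + 1 : ℕ) - Real.log B ≤ (B : ℝ)⁻¹ := by
      rw [← Real.log_div (by positivity) hB.ne']
      refine (Real.log_le_sub_one_of_pos (by positivity)).trans_eq ?_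
      push_cast
      field_simp
      ring
    linarith

/-- A level in `[A, A²)` that is seldom visited. -/
theorem exists_scale (r : ℕ → ℕ) (L : ℕ) {A : ℕ} (hA : 2 ≤ A) :
    ∃ T, A ≤ T ∧ T < A ^ 2 ∧
      (((Finset.range L).filter fun c => r c = T).card * T : ℝ) * Real.log A ≤ L := by
  by_contra hc
  push Not at hc
  have hA0 : (0 : ℝ) < A := by positivity
  have hlog : 0 < Real.log A := Real.log_pos (by exact_mod_cast hA)
  have h1 : ∑ T ∈ Finset.Ico A (A ^ 2), ((Finset.range L).filter fun c => r c = T).card ≤ L := by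
    rw [Finset.sum_card_fiberwise_eq_card_filter]
    simpa using Finset.card_filter_le (Finset.range L) fun c => r c ∈ Finset.Ico A (A ^ 2)
  have h2 : (∑ T ∈ Finset.Ico A (A ^ 2), (T : ℝ)⁻¹) * (L / Real.log A) <
      ∑ T ∈ Finset.Ico A (A ^ 2), (((Finset.range L).filter fun c => r c = T).card : ℝ) := by
    rw [Finset.sum_mul]
    refine Finset.sum_lt_sum_of_nonempty (Finset.nonempty_Ico.2 (by nlinarith)) fun T hT => ?_
    obtain ⟨h3, h4⟩ := Finset.mem_Ico.1 hT
    have hT0 : (0 : ℝ) < T := by exact_mod_cast (by omega : 0 < T)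
    rw [inv_mul_eq_div, div_div, div_lt_iff₀ (by positivity)]
    linarith [hc T h3 h4]
  have h3 := log_sub_log_le_sum_inv (A := A) (B := A ^ 2) (by omega) (by nlinarith)
  have h4 : Real.log A ≤ ∑ T ∈ Finset.Ico A (A ^ 2), (T : ℝ)⁻¹ := by
    push_cast at h3
    rw [Real.log_pow] at h3
    push_cast at h3
    linarith
  have h5 : (L : ℝ) ≤ (∑ T ∈ Finset.Ico A (A ^ 2), (T : ℝ)⁻¹) * (L / Real.log A) :=
    calc (L : ℝ) = Real.log A * (L / Real.log A) := by field_simp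
      _ ≤ _ := by gcongr
  have h6 : (∑ T ∈ Finset.Ico A (A ^ 2),
      (((Finset.range L).filter fun c => r c = T).card : ℝ)) ≤ L := by exact_mod_cast h1
  linarith

/-! ## A maximally dense rising path -/

/-- A horizontal row. -/
def row (r : ℕ) (e : ℤ) : List (ℤ × ℤ) := List.replicate r (e, 0)

theorem length_row (r : ℕ) (e : ℤ) : (row r e).length = r := List.length_replicate

theorem pt_row (e : ℤ) {r i : ℕ} (hi : i ≤ r) : pt (row r e) i = (i * e, 0) := by
  simp [pt, row, List.take_replicate, hi]

theorem noDown_row (r : ℕ) (e : ℤ) : NoDown (row r e) := fun d hd => by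
  rw [List.eq_of_mem_replicate hd]; simp

theorem pru_row_one (r : ℕ) : Pru (row r 1) := by
  have hx : ∀ i ≤ r, px (row r 1) i = i := fun i hi => by simp [px, pt_row _ hi]
  have hy : ∀ i ≤ r, py (row r 1) i = 0 := fun i hi => by simp [py, pt_row _ hi]
  unfold Pru
  rw [length_row]
  refine PrudFn.congr (x := fun i => (i : ℤ)) (y := fun _ => 0) ?_ (fun i hi => ?_) fun i hi => ?_
  · exact ⟨by simp, by simp, fun i _ h => by push_cast at h; omega, by simp, by simp⟩
  · rw [hx i hi]
  · rw [hy i hi]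

theorem pru_row {e : ℤ} (he : e = 1 ∨ e = -1) (r : ℕ) : Pru (row r e) := by
  rcases he with rfl | rfl
  · exact pru_row_one r
  · have := (pru_row_one r).map_act (false, true, false)
    simpa [row, act] using this

theorem pru_up (n : ℕ) : Pru (List.replicate n (0, 1)) := by
  have := (pru_row_one n).map_act (true, false, false)
  simpa [row, act] using this

theorem Ham_row_ge {e : ℤ} (he : e = 1 ∨ e = -1) (r : ℕ) : r - 1 ≤ Ham (row r e) := by
  rw [Ham_eq, length_row, hamFn]
  cases r with
  | zero => simp
  | succ n =>
    rw [Finset.sum_range_succ']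
    refine le_trans ?_ (Nat.le_add_right _ _)
    calc n + 1 - 1 = ∑ j ∈ Finset.range n, 1 := by simp
      _ ≤ _ := Finset.sum_le_sum fun j hj => Finset.card_pos.2 ⟨j, ?_⟩
    rw [Finset.mem_range] at hj
    refine Finset.mem_filter.2 ⟨Finset.mem_Ico.2 ⟨Nat.zero_le _, by omega⟩, ?_⟩
    unfold Touch px py
    rw [pt_row e (by omega), pt_row e (by omega), pt_row e (by omega)]
    push_cast
    rcases he with rfl | rfl <;> ring

/-- Turning back on the next row creates a touching for each step of the row. -/
theorem Ham_turn_ge (c : List (ℤ × ℤ)) {e : ℤ} (he : e = 1 ∨ e = -1) (r : ℕ) :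
    Ham (c ++ row r e) + r + (r - 1) ≤ Ham ((c ++ row r e) ++ (0, 1) :: row r (-e)) := by
  rw [Ham_append (c ++ row r e)]
  have h1 := Ham_le_cons (0, 1) (row r (-e))
  have h2 := Ham_row_ge (e := -e) (by omega) r
  have h3 : r ≤ ∑ j ∈ Finset.range ((0, 1) :: row r (-e)).length,
      ((Finset.Ico 0 (c ++ row r e).length).filter fun i =>
        Touch (px ((c ++ row r e) ++ (0, 1) :: row r (-e)))
          (py ((c ++ row r e) ++ (0, 1) :: row r (-e))) i ((c ++ row r e).length + j)).card := by
    rw [List.length_cons, length_row, Finset.sum_range_succ']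
    refine le_trans ?_ (Nat.le_add_right _ _)
    calc r = ∑ j ∈ Finset.range r, 1 := by simp
      _ ≤ _ := Finset.sum_le_sum fun j hj => Finset.card_pos.2
        ⟨c.length + (r - (j + 1)), ?_⟩
    rw [Finset.mem_range] at hj
    have hlen : (c ++ row r e).length = c.length + r := by rw [List.length_append, length_row]
    have p1 : ∀ i ≤ r, pt ((c ++ row r e) ++ (0, 1) :: row r (-e)) (c.length + i) =
        pt c c.length + (i * e, 0) := fun i hi => by
      rw [pt_append_left _ _ (by omega), pt_append_right, pt_row _ hi]
    have p2 : ∀ i ≤ r, pt ((c ++ row r e) ++ (0, 1) :: row r (-e))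
        ((c ++ row r e).length + (i + 1)) =
        pt c c.length + (r * e, 0) + ((0, 1) + (i * (-e), 0)) := fun i hi => by
      rw [pt_append_right, pt_cons, pt_row _ hi, hlen, pt_append_right, pt_row _ le_rfl]
    refine Finset.mem_filter.2 ⟨Finset.mem_Ico.2 ⟨Nat.zero_le _, by omega⟩, ?_⟩
    unfold Touch px py
    rw [add_assoc, add_assoc _ (j + 1) 1, p1 _ (by omega), p1 _ (by omega), p2 _ (by omega),
      p2 _ (by omega)]
    simp only [Prod.fst_add, Prod.snd_add]
    have e1 : ((r - (j + 1) : ℕ) : ℤ) = r - (j + 1) := by omega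
    push_cast
    rw [e1]
    ring
  omega

/-- `n` rows of length `r`, traversed in alternating directions. -/
def zigzag (r : ℕ) : ℕ → List (ℤ × ℤ)
  | 0 => []
  | n + 1 => zigzag r n ++ (0, 1) :: row r ((-1) ^ n)

theorem length_zigzag (r n : ℕ) : (zigzag r n).length = n * (r + 1) := by
  induction n with
  | zero => simp [zigzag]
  | succ n ih => rw [zigzag, length_append_up, ih, length_row]; ring

theorem noDown_zigzag (r n : ℕ) : NoDown (zigzag r n) := by
  induction n with
  | zero => simp [zigzag, NoDown]
  | succ n ih => exact ih.append_up (noDown_row _ _)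

theorem pru_zigzag (r n : ℕ) : Pru (zigzag r n) := by
  induction n with
  | zero => exact pru_nil
  | succ n ih =>
    exact ih.append_noDown ((noDown_zigzag r n).isRec ih le_rfl)
      (pru_row (neg_one_pow_eq_or ℤ n) r) (noDown_row _ _)

theorem Ham_zigzag_ge (r n : ℕ) : (n + 1) * (r - 1) + n * r ≤ Ham (zigzag r (n + 1)) := by
  induction n with
  | zero =>
    have h1 := Ham_le_cons (0, 1) (row r 1)
    have h2 := Ham_row_ge (.inl rfl) r
    simp only [zigzag, pow_zero, List.nil_append]
    omega
  | succ n ih =>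
    have h1 := Ham_turn_ge (zigzag r n ++ [(0, 1)]) (neg_one_pow_eq_or ℤ n) r
    have e1 : (zigzag r n ++ [(0, 1)]) ++ row r ((-1) ^ n) = zigzag r (n + 1) := by simp [zigzag]
    rw [e1, show -((-1 : ℤ) ^ n) = (-1) ^ (n + 1) by ring] at h1
    rw [zigzag]
    calc _ = (n + 1) * (r - 1) + n * r + r + (r - 1) := by ring
      _ ≤ _ := by omega

/-- For every `M` there is a rising path of length about `M` with about `2 M` self-touchings. -/
theorem exists_dense (M : ℕ) : ∃ D : List (ℤ × ℤ), Pru D ∧ NoDown D ∧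
    D.length ≤ M + 3 * M.sqrt + 2 ∧ 2 * M ≤ Ham D + 2 * M.sqrt := by
  refine ⟨zigzag (M.sqrt + 1) (M.sqrt + 1), pru_zigzag _ _, noDown_zigzag _ _, ?_, ?_⟩
  · rw [length_zigzag]
    have := Nat.sqrt_le M
    nlinarith
  · have h1 := Ham_zigzag_ge (M.sqrt + 1) M.sqrt
    have h2 := Nat.sqrt_le_add M
    rw [Nat.add_sub_cancel] at h1
    nlinarith

/-! ## Encoding a prudent path by a two-sided one -/

theorem noDown_up (n : ℕ) : NoDown (List.replicate n (0, 1)) := fun d hd => by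
  rw [List.eq_of_mem_replicate hd]; simp

/-- The number of steps by which the reassembled path exceeds the original one. -/
def excess (L K : ℕ) : ℕ := K + 3 * (L + K).sqrt + 5

theorem Assembled.exists_twoSided {w : List (ℤ × ℤ)} {T k K : ℕ}
    (h : Assembled w T w.length k) (hk : k ≤ K) :
    ∃ (w' : List (ℤ × ℤ)) (q : ℕ) (cs : List PieceCode), Pru w' ∧ TwoSided w' ∧
      w'.length = w.length + excess w.length K ∧ q ≤ w.length + K ∧ cs.length ≤ K ∧
      (∀ c ∈ cs, c.2.1 ≤ w.length + K ∧ c.2.2.1 ≤ w.length + K) ∧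
      decode w' (w'.drop (q + 1)) cs = w ∧
      Ham w ≤ Ham w' + 2 * (w.length + K).sqrt + k * (10 * T) := by
  obtain ⟨Q, R, M, cs, h1, h2, h3, h4, h5, h6, h7, h8, h9, h10⟩ := h
  obtain ⟨D, d1, d2, d3, d4⟩ := exists_dense M
  have hsqrt : M.sqrt ≤ (w.length + K).sqrt := Nat.sqrt_le_sqrt (by omega)
  set n := w.length + excess w.length K - (Q.length + R.length + D.length + 3) with hn
  set U := D ++ (0, 1) :: List.replicate n (0, 1) with hU
  have hUp : Pru U := d1.append_noDown (d2.isRec d1 le_rfl) (pru_up n) (noDown_up n)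
  have hUd : NoDown U := d2.append_up (noDown_up n)
  have hVp : Pru (R ++ (0, 1) :: U) := h4.append_noDown (h5.isRec h4 le_rfl) hUp hUd
  have hVd : NoDown (R ++ (0, 1) :: U) := h5.append_up hUd
  refine ⟨Q ++ (0, 1) :: (R ++ (0, 1) :: U), Q.length, cs, h1.append_noDown h3.2 hVp hVd,
    h2.append_up h3.2 fun i hi => .inr (hVd.isRec hVp hi), ?_, by omega, by omega,
    fun c hc => ?_, ?_, ?_⟩
  · rw [length_append_up, length_append_up, hU, length_append_up, List.length_replicate, hn]
    unfold excess
    omega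
  · have := h7 c hc
    omega
  · have := h8 ((0, 1) :: (R ++ (0, 1) :: U)) ((0, 1) :: U)
    rw [List.take_length] at this
    rw [List.drop_append, List.drop_eq_nil_of_le (by omega), List.nil_append,
      show Q.length + 1 - Q.length = 1 by omega, List.drop_one, List.tail_cons, this]
  · rw [List.take_length] at h9
    have a1 := Ham_add_le Q ((0, 1) :: (R ++ (0, 1) :: U))
    have a2 := Ham_le_cons (0, 1) (R ++ (0, 1) :: U)
    have a3 := Ham_add_le R ((0, 1) :: U)
    have a4 := Ham_le_cons (0, 1) U
    have a5 := Ham_add_le D ((0, 1) :: List.replicate n (0, 1))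
    rw [← hU] at a5
    omega

/-- A numbering of the kinds of pieces. -/
def kindOf : Fin 3 → PieceKind := ![.corner, .rising, .line]

theorem kindOf_surjective : Function.Surjective kindOf
  | .corner => ⟨0, rfl⟩
  | .rising => ⟨1, rfl⟩
  | .line => ⟨2, rfl⟩

/-- Piece codes with bounded entries. -/
abbrev BoundedCode (B : ℕ) := Fin 3 × Fin B × Fin B × (Bool × Bool × Bool)

/-- The piece code given by a bounded code. -/
def BoundedCode.toCode {B : ℕ} (c : BoundedCode B) : PieceCode :=
  (kindOf c.1, c.2.1, c.2.2.1, c.2.2.2)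

theorem exists_boundedCode {B : ℕ} {c : PieceCode} (h : c.2.1 < B) (h' : c.2.2.1 < B) :
    ∃ d : BoundedCode B, d.toCode = c := by
  obtain ⟨a, ha⟩ := kindOf_surjective c.1
  exact ⟨(a, ⟨_, h⟩, ⟨_, h'⟩, c.2.2.2), by unfold BoundedCode.toCode; rw [ha]⟩

theorem exists_bounded_codes {B K : ℕ} (hB : 0 < B) {cs : List PieceCode} (hK : cs.length ≤ K)
    (hcs : ∀ c ∈ cs, c.2.1 < B ∧ c.2.2.1 < B) :
    ∃ f : Fin K → BoundedCode B, ∀ Q R,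
      decode Q R ((List.ofFn f).map BoundedCode.toCode) = decode Q R cs := by
  set p : PieceCode := (.line, 0, 0, (false, false, false)) with hp
  set cs' := cs ++ List.replicate (K - cs.length) p with hcs'
  have hlen : cs'.length = K := by simp [hcs', hK]
  have hex : ∀ i : Fin K, ∃ d : BoundedCode B, d.toCode = cs'[i] := by
    intro i
    have hmem : cs'[i] ∈ cs' := List.getElem_mem _
    rcases List.mem_append.1 hmem with h | h
    · exact exists_boundedCode (hcs _ h).1 (hcs _ h).2
    · rw [List.eq_of_mem_replicate h]
      exact exists_boundedCode hB hB
  choose f hf using hex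
  refine ⟨f, fun Q R => ?_⟩
  have e : (List.ofFn f).map BoundedCode.toCode = cs' := by
    rw [List.map_ofFn]
    refine List.ext_getElem (by simp [hlen]) fun i h1 h2 => ?_
    simp [hf]
  rw [e, hcs']
  simp [decode, hp, decodePiece, straight]

theorem dirs_injective : Function.Injective dirs := by decide

theorem stepsOf_injective {L : ℕ} : Function.Injective (stepsOf (L := L)) := fun _ _ h =>
  List.ofFn_injective (List.map_injective_iff.2 dirs_injective h)

theorem length_stepsOf {L : ℕ} (s : Fin L → Fin 4) : (stepsOf s).length = L := by simp [stepsOf]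

theorem dirs_cases (a : Fin 4) :
    dirs a = (1, 0) ∨ dirs a = (-1, 0) ∨ dirs a = (0, 1) ∨ dirs a = (0, -1) := by
  revert a; decide

theorem pru_stepsOf {L : ℕ} {s : Fin L → Fin 4} (h : IsPrudent (stepsOf s)) : Pru (stepsOf s) :=
  h.pru fun d hd => by
    obtain ⟨a, _, rfl⟩ := List.mem_map.1 hd
    exact dirs_cases a

theorem Pru.exists_stepsOf {w : List (ℤ × ℤ)} (h : Pru w) {L : ℕ} (hL : w.length = L) :
    ∃ s : Fin L → Fin 4, stepsOf s = w := by
  have hd : ∀ d ∈ w, ∃ a, dirs a = d := fun d hd => by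
    rcases h.mem_cases hd with rfl | rfl | rfl | rfl
    · exact ⟨0, rfl⟩
    · exact ⟨1, rfl⟩
    · exact ⟨2, rfl⟩
    · exact ⟨3, rfl⟩
  have hex : ∀ i : Fin L, ∃ a, dirs a = w[i] := fun i => hd _ (List.getElem_mem _)
  choose s hs using hex
  refine ⟨s, List.ext_getElem (by rw [length_stepsOf, hL]) fun i h1 h2 => ?_⟩
  simp [stepsOf, hs]

/-- The information needed to recover a prudent path from an NE-prudent one. -/
abbrev PathCode (L K : ℕ) := (Fin (excess L K) → Fin 4) × Fin (L + K + 1) ×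
  (Fin K → BoundedCode (L + K + 1))

/-- The recovery of a prudent path from an NE-prudent one. -/
def PathCode.recover {L K : ℕ} (c : PathCode L K) (s : Fin L → Fin 4) : List (ℤ × ℤ) :=
  decode (stepsOf s ++ stepsOf c.1) ((stepsOf s ++ stepsOf c.1).drop (c.2.1 + 1))
    ((List.ofFn c.2.2).map BoundedCode.toCode)

theorem exists_pathCode {L T k K : ℕ} {s : Fin L → Fin 4}
    (h : Assembled (stepsOf s) T L k) (hk : k ≤ K) :
    ∃ (c : PathCode L K), ∃ s' ∈ neFinset L, c.recover s' = stepsOf s ∧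
      Ham (stepsOf s) ≤ Ham (stepsOf s') + 2 * excess L K + 2 * (L + K).sqrt + k * (10 * T) := by
  have hL := length_stepsOf s
  obtain ⟨w', q, cs, h1, h2, h3, h4, h5, h6, h7, h8⟩ :=
    Assembled.exists_twoSided (by rw [hL]; exact h) hk
  rw [hL] at h3 h4 h6 h8
  obtain ⟨s', hs'⟩ := (h1.prefix L).exists_stepsOf (L := L) (by rw [List.length_take]; omega)
  have hdrop : Pru (w'.drop L) := by
    rw [← List.take_append_drop L w'] at h1
    exact h1.of_append_right
  obtain ⟨v, hv⟩ := hdrop.exists_stepsOf (L := excess L K) (by rw [List.length_drop]; omega)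
  obtain ⟨f, hf⟩ := exists_bounded_codes (B := L + K + 1) (by omega) h5 fun c hc => by
    have := h6 c hc
    omega
  have e : stepsOf s' ++ stepsOf v = w' := by rw [hs', hv, List.take_append_drop]
  have hts : TwoSided (w'.take L) := by
    rw [← List.take_append_drop L w'] at h2
    exact h2.of_append_left
  refine ⟨(v, ⟨q, by omega⟩, f), s', ?_, ?_, ?_⟩
  · simp only [neFinset, Finset.mem_filter, Finset.mem_univ, true_and, hs']
    exact (h1.prefix L).isNEPath hts
  · unfold PathCode.recover
    dsimp only
    rw [e, hf, h7]
  · rw [← e] at h1 h8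
    have := h1.Ham_append_le
    rw [length_stepsOf] at this
    omega

theorem sum_exp_le_card_mul {α γ δ : Type*} [Fintype γ] {P N : Finset α} (dec : γ → α → δ)
    {e : α → δ} (he : Function.Injective e) {H : α → ℝ} {err β : ℝ} (hβ : 0 ≤ β)
    (h : ∀ s ∈ P, ∃ c, ∃ s' ∈ N, dec c s' = e s ∧ H s ≤ H s' + err) :
    ∑ s ∈ P, Real.exp (β * H s) ≤
      Fintype.card γ * Real.exp (β * err) * ∑ s ∈ N, Real.exp (β * H s) := by
  classical
  have h' : ∀ s : P, ∃ p : γ × α, p.2 ∈ N ∧ dec p.1 p.2 = e s ∧ H s ≤ H p.2 + err := fun s => by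
    obtain ⟨c, s', h1, h2⟩ := h s s.2
    exact ⟨(c, s'), h1, h2⟩
  choose φ hφ using h'
  have hinj : Function.Injective φ := fun a b hab => Subtype.ext <| he <| by
    rw [← (hφ a).2.1, ← (hφ b).2.1, hab]
  calc ∑ s ∈ P, Real.exp (β * H s) = ∑ s : P, Real.exp (β * H s) :=
        (Finset.sum_coe_sort P fun s => Real.exp (β * H s)).symm
    _ ≤ ∑ s : P, Real.exp (β * err) * Real.exp (β * H (φ s).2) := by
        refine Finset.sum_le_sum fun s _ => ?_
        rw [← Real.exp_add, ← mul_add]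
        have := (hφ s).2.2
        gcongr
        linarith
    _ = ∑ p ∈ Finset.univ.image φ, Real.exp (β * err) * Real.exp (β * H p.2) := by
        rw [Finset.sum_image fun a _ b _ hab => hinj hab]
    _ ≤ ∑ p ∈ Finset.univ ×ˢ N, Real.exp (β * err) * Real.exp (β * H p.2) := by
        refine Finset.sum_le_sum_of_subset_of_nonneg ?_ fun _ _ _ => by positivity
        intro p hp
        obtain ⟨s, _, rfl⟩ := Finset.mem_image.1 hp
        exact Finset.mem_product.2 ⟨Finset.mem_univ _, (hφ s).1⟩
    _ = _ := by
        rw [Finset.sum_product]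
        dsimp only
        rw [Finset.sum_const, ← Finset.mul_sum, Finset.card_univ, nsmul_eq_mul, mul_assoc]

theorem card_pathCode (L K : ℕ) : Fintype.card (PathCode L K) =
    4 ^ excess L K * ((L + K + 1) * (24 * (L + K + 1) ^ 2) ^ K) := by
  simp only [Fintype.card_prod, Fintype.card_fun, Fintype.card_fin, Fintype.card_bool]
  congr 3
  ring

/-! ## Asymptotics -/

theorem Zne_le_Zpsaw (β : ℝ) (L : ℕ) : Zne β L ≤ Zpsaw β L := by
  unfold Zne Zpsaw
  refine Finset.sum_le_sum_of_subset_of_nonneg (fun s hs => ?_) fun _ _ _ => (Real.exp_pos _).le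
  simp only [neFinset, psawFinset, Finset.mem_filter] at hs ⊢
  exact ⟨hs.1, hs.2.1⟩

theorem Zne_pos (β : ℝ) (L : ℕ) : 0 < Zne β L := by
  obtain ⟨s, hs⟩ := (pru_up L).exists_stepsOf (L := L) (by simp)
  refine Finset.sum_pos (fun _ _ => Real.exp_pos _) ⟨s, ?_⟩
  simp only [neFinset, Finset.mem_filter, Finset.mem_univ, true_and, hs]
  exact (pru_up L).isNEPath ((noDown_up L).twoSided (pru_up L))

/-- A bound on the number of pieces at scale `A`. -/
def pieceBound (A L : ℕ) : ℕ := 2 * (L / A ^ 4) + 8 * A ^ 4 + 14 + 4 * (L / A)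

section scale

variable {A L : ℕ}

theorem one_le_log (hA : 3 ≤ A) : 1 ≤ Real.log A := by
  rw [Real.le_log_iff_exp_le (by positivity)]
  have h1 : (3 : ℝ) ≤ A := by exact_mod_cast hA
  linarith [Real.exp_one_lt_d9]

theorem pow_mul_le (hA : 3 ≤ A) (hL : A ^ 8 ≤ L) {n : ℕ} (hn : n ≤ 7) :
    (A : ℝ) ^ n ≤ L / A := by
  have h0 : (0 : ℝ) < A := by positivity
  rw [le_div_iff₀ h0, ← pow_succ]
  calc (A : ℝ) ^ (n + 1) ≤ (A : ℝ) ^ 8 :=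
        pow_le_pow_right₀ (by exact_mod_cast (by omega : 1 ≤ A)) (by omega)
    _ ≤ L := by exact_mod_cast hL

theorem div_pow_four_mul_sq_le (hA : 3 ≤ A) : ((L / A ^ 4 : ℕ) : ℝ) * A ^ 2 ≤ L / A := by
  have h0 : (0 : ℝ) < A := by positivity
  have h1 : (1 : ℝ) ≤ A := by exact_mod_cast (by omega : 1 ≤ A)
  calc ((L / A ^ 4 : ℕ) : ℝ) * A ^ 2 ≤ L / ((A ^ 4 : ℕ) : ℝ) * A ^ 2 := by
        gcongr; exact Nat.cast_div_le
    _ = (L : ℝ) / (A : ℝ) ^ 2 := by push_cast; field_simp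
    _ ≤ (L : ℝ) / A := by gcongr; exact le_self_pow₀ h1 (by norm_num)

theorem pieceBound_le (hA : 3 ≤ A) (hL : A ^ 8 ≤ L) : (pieceBound A L : ℝ) ≤ 28 * (L / A) := by
  have h1 : (1 : ℝ) ≤ A := by exact_mod_cast (by omega : 1 ≤ A)
  have h2 := pow_mul_le hA hL (n := 4) (by norm_num)
  have h3 := pow_mul_le hA hL (n := 0) (by norm_num)
  have h4 : ((L / A : ℕ) : ℝ) ≤ L / A := Nat.cast_div_le
  have h5 := div_pow_four_mul_sq_le (L := L) hA
  have h6 : ((L / A ^ 4 : ℕ) : ℝ) ≤ ((L / A ^ 4 : ℕ) : ℝ) * A ^ 2 :=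
    le_mul_of_one_le_right (by positivity) (one_le_pow₀ h1)
  rw [pow_zero] at h3
  unfold pieceBound
  push_cast at *
  linarith

theorem pieceBound_le_mul (hA : 3 ≤ A) (hL : A ^ 8 ≤ L) : pieceBound A L ≤ 28 * L := by
  have h1 := pieceBound_le hA hL
  have h2 : (L : ℝ) / A ≤ L := div_le_self (by positivity) (by exact_mod_cast (by omega : 1 ≤ A))
  have : (pieceBound A L : ℝ) ≤ 28 * L := by linarith
  exact_mod_cast this

theorem sqrt_add_pieceBound_le (hA : 3 ≤ A) (hL : A ^ 8 ≤ L) :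
    ((L + pieceBound A L).sqrt : ℝ) ≤ 6 * (L / A) := by
  have h0 : (0 : ℝ) < A := by positivity
  have h1 : ((L + pieceBound A L).sqrt : ℝ) ^ 2 ≤ 29 * L := by
    have h2 := Nat.sqrt_le' (L + pieceBound A L)
    have h3 := pieceBound_le_mul hA hL
    exact_mod_cast (by omega : (L + pieceBound A L).sqrt ^ 2 ≤ 29 * L)
  have h4 := pow_mul_le hA hL (n := 1) (by norm_num)
  have h5 : (L : ℝ) ≤ (L / A) ^ 2 := by
    calc (L : ℝ) = A ^ 1 * (L / A) := by field_simp
      _ ≤ (L / A) * (L / A) := by gcongr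
      _ = _ := by ring
  have h6 : (0 : ℝ) ≤ L / A := by positivity
  refine abs_le_of_sq_le_sq' (a := ((L + pieceBound A L).sqrt : ℝ)) ?_ (by positivity) |>.2
  nlinarith

theorem excess_le (hA : 3 ≤ A) (hL : A ^ 8 ≤ L) :
    (excess L (pieceBound A L) : ℝ) ≤ 51 * (L / A) := by
  have h1 := pieceBound_le hA hL
  have h2 := sqrt_add_pieceBound_le hA hL
  have h3 := pow_mul_le hA hL (n := 0) (by norm_num)
  rw [pow_zero] at h3
  unfold excess
  push_cast
  linarith

theorem log_card_pathCode_le (hA : 3 ≤ A) (hL : A ^ 8 ≤ L) (hL' : L < (A + 1) ^ 8) :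
    Real.log (Fintype.card (PathCode L (pieceBound A L))) ≤
      80 * (L / A) * (Real.log 21600 + 16 * Real.log (A + 1)) := by
  set K := pieceBound A L with hK
  set Λ := Real.log 21600 + 16 * Real.log (A + 1) with hΛ
  have hL0 : 1 ≤ L := le_trans (Nat.one_le_pow _ _ (by omega)) hL
  have hB : ((L : ℝ) + K + 1) ≤ 30 * L := by
    have := pieceBound_le_mul hA hL
    exact_mod_cast (by omega : L + K + 1 ≤ 30 * L)
  have hB1 : (1 : ℝ) ≤ (L : ℝ) + K + 1 := by
    have : (0 : ℝ) ≤ (L : ℝ) + K := by positivity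
    linarith
  have hLA : (L : ℝ) ≤ (A + 1) ^ 8 := by exact_mod_cast hL'.le
  have k1 : Real.log (24 * ((L : ℝ) + K + 1) ^ 2) ≤ Λ := by
    have e : Λ = Real.log (24 * (30 * (A + 1 : ℝ) ^ 8) ^ 2) := by
      rw [hΛ, show (24 * (30 * (A + 1 : ℝ) ^ 8) ^ 2) = 21600 * (A + 1) ^ 16 by ring,
        Real.log_mul (by norm_num) (by positivity), Real.log_pow]
      norm_num
    rw [e]
    have hB' : ((L : ℝ) + K + 1) ≤ 30 * (A + 1) ^ 8 := hB.trans (by gcongr)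
    exact Real.log_le_log (by positivity) (by gcongr)
  have k2 : Real.log ((L : ℝ) + K + 1) ≤ Λ :=
    (Real.log_le_log (by positivity) (by nlinarith)).trans k1
  have k3 : Real.log 4 ≤ Λ := (Real.log_le_log (by norm_num) (by nlinarith)).trans k1
  have hΛ0 : 0 ≤ Λ := (Real.log_nonneg hB1).trans k2
  rw [card_pathCode]
  push_cast
  rw [Real.log_mul (by positivity) (by positivity), Real.log_mul (by positivity) (by positivity),
    Real.log_pow, Real.log_pow]
  have h1 := excess_le hA hL
  have h2 := pieceBound_le hA hL
  have h3 := pow_mul_le hA hL (n := 0) (by norm_num)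
  rw [pow_zero] at h3
  rw [← hK] at h1 h2
  calc _ ≤ (excess L K : ℝ) * Λ + (1 * Λ + K * Λ) := by rw [one_mul]; gcongr
    _ ≤ 51 * (L / A) * Λ + (L / A * Λ + 28 * (L / A) * Λ) := by gcongr
    _ = _ := by ring

theorem Zpsaw_le_card_mul {β : ℝ} (hβ : 0 ≤ β) (hA : 3 ≤ A) (hL : A ^ 8 ≤ L) :
    Zpsaw β L ≤ Fintype.card (PathCode L (pieceBound A L)) *
      Real.exp (β * (394 * (L / Real.log A))) * Zne β L := by
  have h0 : (0 : ℝ) < A := by positivity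
  have hlog := one_le_log hA
  have hlog0 : 0 < Real.log A := by linarith
  have hAlog : (L : ℝ) / A ≤ L / Real.log A := by
    gcongr
    exact (Real.log_le_sub_one_of_pos h0).trans (by linarith)
  refine sum_exp_le_card_mul (fun (c : PathCode L (pieceBound A L)) s => c.recover s)
    stepsOf_injective hβ fun s hs => ?_
  have hp : Pru (stepsOf s) := pru_stepsOf (by
    simp only [psawFinset, Finset.mem_filter] at hs
    exact hs.2)
  obtain ⟨T, hAT, hTA, hT⟩ := exists_scale (runPos (px (stepsOf s)) (py (stepsOf s))) L
    (show 2 ≤ A by omega)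
  set N := ((Finset.range L).filter fun c =>
    runPos (px (stepsOf s)) (py (stepsOf s)) c = T).card with hN
  have hNT : (N : ℝ) * T ≤ L / Real.log A := by rwa [le_div_iff₀ hlog0]
  have hNA : N ≤ L / A := by
    rw [Nat.le_div_iff_mul_le (by omega)]
    have h1 : (N : ℝ) * T ≤ L := hNT.trans (div_le_self (by positivity) hlog)
    have h2 : N * T ≤ L := by exact_mod_cast h1
    exact (Nat.mul_le_mul_left N hAT).trans h2
  have has := hp.assembled (S := A ^ 4) (T := T) (by positivity) (by omega)
  rw [length_stepsOf] at has
  obtain ⟨c, s', hs', hc, hH⟩ := exists_pathCode (K := pieceBound A L) has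
    (by unfold pieceBound; omega)
  refine ⟨c, s', hs', hc, ?_⟩
  have hH' : (Ham (stepsOf s) : ℝ) ≤ Ham (stepsOf s') + 2 * excess L (pieceBound A L) +
      2 * (L + pieceBound A L).sqrt +
      (2 * ((L / A ^ 4 : ℕ) : ℝ) + 8 * A ^ 4 + 14 + 4 * N) * (10 * T) := by exact_mod_cast hH
  have hT2 : (T : ℝ) ≤ A ^ 2 := by exact_mod_cast hTA.le
  have h1 := excess_le hA hL
  have h2 := sqrt_add_pieceBound_le hA hL
  have h3 : ((L / A ^ 4 : ℕ) : ℝ) * T ≤ L / A :=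
    (by gcongr : _ ≤ ((L / A ^ 4 : ℕ) : ℝ) * A ^ 2).trans (div_pow_four_mul_sq_le hA)
  have h4 : (A : ℝ) ^ 4 * T ≤ L / A := by
    calc (A : ℝ) ^ 4 * T ≤ A ^ 4 * A ^ 2 := by gcongr
      _ = (A : ℝ) ^ 6 := by ring
      _ ≤ L / A := pow_mul_le hA hL (by norm_num)
  have h5 : (T : ℝ) ≤ L / A := hT2.trans (pow_mul_le hA hL (by norm_num))
  linarith

theorem log_Zpsaw_div_Zne_le {β : ℝ} (hβ : 0 ≤ β) (hA : 3 ≤ A) (hL : A ^ 8 ≤ L)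
    (hL' : L < (A + 1) ^ 8) :
    Real.log (Zpsaw β L / Zne β L) ≤
      L * (80 * (Real.log 21600 + 16 * Real.log (A + 1)) / A + β * 394 / Real.log A) := by
  have hZ := Zne_pos β L
  have hZ' : 0 < Zpsaw β L := hZ.trans_le (Zne_le_Zpsaw β L)
  have hcard : (0 : ℝ) < Fintype.card (PathCode L (pieceBound A L)) := by
    rw [card_pathCode]; positivity
  have h1 : Zpsaw β L / Zne β L ≤ Fintype.card (PathCode L (pieceBound A L)) *
      Real.exp (β * (394 * (L / Real.log A))) := by
    rw [div_le_iff₀ hZ]; exact Zpsaw_le_card_mul hβ hA hL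
  have h2 := Real.log_le_log (by positivity) h1
  rw [Real.log_mul hcard.ne' (Real.exp_pos _).ne', Real.log_exp] at h2
  have h3 := log_card_pathCode_le hA hL hL'
  refine (h2.trans (add_le_add_left h3 _)).trans_eq ?_
  ring

end scale

/-- The integer part of the eighth root. -/
def eighthRoot (L : ℕ) : ℕ := L.sqrt.sqrt.sqrt

theorem eighthRoot_pow_le (L : ℕ) : eighthRoot L ^ 8 ≤ L := by
  have h1 := Nat.sqrt_le' L
  have h2 := Nat.sqrt_le' L.sqrt
  have h3 := Nat.sqrt_le' L.sqrt.sqrt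
  calc eighthRoot L ^ 8 = ((L.sqrt.sqrt.sqrt ^ 2) ^ 2) ^ 2 := by unfold eighthRoot; ring
    _ ≤ ((L.sqrt.sqrt) ^ 2) ^ 2 := by gcongr
    _ ≤ L.sqrt ^ 2 := by gcongr
    _ ≤ L := h1

theorem lt_eighthRoot_pow (L : ℕ) : L < (eighthRoot L + 1) ^ 8 := by
  have h1 := Nat.lt_succ_sqrt' L
  have h2 := Nat.lt_succ_sqrt' L.sqrt
  have h3 := Nat.lt_succ_sqrt' L.sqrt.sqrt
  calc L < (L.sqrt + 1) ^ 2 := h1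
    _ ≤ ((L.sqrt.sqrt + 1) ^ 2) ^ 2 := by gcongr; exact h2
    _ ≤ (((L.sqrt.sqrt.sqrt + 1) ^ 2) ^ 2) ^ 2 := by gcongr; exact h3
    _ = _ := by unfold eighthRoot; ring

theorem tendsto_eighthRoot : Tendsto eighthRoot atTop atTop := by
  refine tendsto_atTop.2 fun B => (eventually_ge_atTop (B ^ 8)).mono fun L hL => ?_
  have := lt_of_pow_lt_pow_left' 8 (hL.trans_lt (lt_eighthRoot_pow L))
  omega

theorem tendsto_error (β : ℝ) :
    Tendsto (fun A : ℕ => 80 * (Real.log 21600 + 16 * Real.log ((A : ℝ) + 1)) / A +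
      β * 394 / Real.log A) atTop (nhds 0) := by
  have hinv : Tendsto (fun A : ℕ => ((A : ℝ))⁻¹) atTop (nhds 0) := tendsto_inv_atTop_nhds_zero_nat
  have h1 : Tendsto (fun A : ℕ => Real.log ((A : ℝ) + 1) / A) atTop (nhds 0) := by
    have h2 : Tendsto (fun x : ℝ => Real.log x / x) atTop (nhds 0) := by
      simpa using Real.tendsto_pow_log_div_mul_add_atTop 1 0 1 one_ne_zero
    have h3 := h2.comp
      (tendsto_atTop_add_const_right _ (1 : ℝ) (tendsto_natCast_atTop_atTop (R := ℝ)))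
    have h4 : Tendsto (fun A : ℕ => 1 + ((A : ℝ))⁻¹) atTop (nhds (1 + 0)) := hinv.const_add 1
    have h5 := h3.mul h4
    rw [zero_mul] at h5
    refine h5.congr' ((eventually_gt_atTop 0).mono fun A hA => ?_)
    have : (0 : ℝ) < A := by exact_mod_cast hA
    simp only [Function.comp]
    field_simp
  have h6 : Tendsto (fun A : ℕ => β * 394 / Real.log A) atTop (nhds 0) :=
    (Real.tendsto_log_atTop.comp tendsto_natCast_atTop_atTop).const_div_atTop _
  have h7 := ((hinv.const_mul (80 * Real.log 21600)).add (h1.const_mul (80 * 16))).add h6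
  simp only [mul_zero, add_zero] at h7
  refine h7.congr fun A => ?_
  ring

/-- `Z^NE_{β,L} ≤ Z_{β,L}` for every `L`, and `Z_{β,L} ≤ e^{ε(L)} Z^NE_{β,L}`
for a sub-linear error function `ε`. -/
theorem Zpsaw_le_exp_mul_Zne (β : ℝ) (hβ : 0 ≤ β) :
    (∀ L : ℕ, Zne β L ≤ Zpsaw β L) ∧
    ∃ ε : ℕ → ℝ, (∀ L, 0 ≤ ε L) ∧
      Tendsto (fun L : ℕ => ε L / (L : ℝ)) atTop (nhds 0) ∧
      ∀ L : ℕ, Zpsaw β L ≤ Real.exp (ε L) * Zne β L := by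
  have hε : ∀ L, 0 ≤ Real.log (Zpsaw β L / Zne β L) := fun L =>
    Real.log_nonneg ((one_le_div (Zne_pos β L)).2 (Zne_le_Zpsaw β L))
  refine ⟨Zne_le_Zpsaw β, fun L => Real.log (Zpsaw β L / Zne β L), hε, ?_, fun L => ?_⟩
  · refine squeeze_zero' (Eventually.of_forall fun L => div_nonneg (hε L) (by positivity)) ?_
      ((tendsto_error β).comp tendsto_eighthRoot)
    filter_upwards [tendsto_eighthRoot.eventually_ge_atTop 3, eventually_gt_atTop 0] with L hA hL
    rw [div_le_iff₀ (by exact_mod_cast hL), mul_comm]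
    exact log_Zpsaw_div_Zne_le hβ hA (eighthRoot_pow_le L) (lt_eighthRoot_pow L)
  · have hZ := Zne_pos β L
    rw [Real.exp_log (div_pos (hZ.trans_le (Zne_le_Zpsaw β L)) hZ), div_mul_cancel₀ _ hZ.ne']
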